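/- Every Borel Gale-Stewart game is determined: if T is a nonempty pruned tree and P ⊆ [T] is Borel in the topology of [T], then one of the two players has a winning strategy in (T, P). -/

import Mathlib

universe u

namespace GS

variable {A B C : Type u}

/-- A tree on `A`: a set of finite sequences closed under prefixes. -/
def IsTree (T : Set (List A)) : Prop := ∀ ⦃x y : List A⦄, x <+: y → y ∈ T → x ∈ T

/-- A tree is pruned if every node has a proper extension in the tree. -/
def IsPruned (T : Set (List A)) : Prop := ∀ x ∈ T, ∃ a : A, x ++ [a] ∈ T

/-- The body of a tree: infinite sequences all of whose finite prefixes lie in the tree. -/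
def body (T : Set (List A)) : Set (ℕ → A) :=
  {a | ∀ n : ℕ, (List.ofFn fun i : Fin n => a i) ∈ T}

/-- The product of the discrete topologies on `ℕ → A`. -/
def seqTop (A : Type u) : TopologicalSpace (ℕ → A) :=
  @Pi.topologicalSpace ℕ (fun _ => A) (fun _ => ⊥)

/-- The subspace topology on the body of a tree. -/
def bodyTop (T : Set (List A)) : TopologicalSpace {a // a ∈ body T} :=
  TopologicalSpace.induced Subtype.val (seqTop A)

/-- A (functional) strategy for player `i` on the tree `T`: to each position of player `i`
(i.e. of length `≡ i (mod 2)`) in `T` it assigns a legal move. -/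
structure Strategy (T : Set (List A)) (i : ℕ) where
  move : List A → A
  legal : ∀ x ∈ T, x.length % 2 = i % 2 → x ++ [move x] ∈ T

/-- A play is consistent with a strategy of player `i` if all moves of player `i` are
given by the strategy. -/
def Consistent {T : Set (List A)} {i : ℕ} (σ : Strategy T i) (a : ℕ → A) : Prop :=
  ∀ n : ℕ, n % 2 = i % 2 → a n = σ.move (List.ofFn fun j : Fin n => a j)

/-- The plays (branches of the tree) consistent with a strategy; this is the body `[σ]`
of the strategy tree of `σ`. -/
def plays {T : Set (List A)} {i : ℕ} (σ : Strategy T i) : Set (ℕ → A) :=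
  {a ∈ body T | Consistent σ a}

/-- A strategy of player `i` is winning in the game `(T, P)` if every play consistent with it
is won by player `i`. -/
def WinningStrategy (T : Set (List A)) (P : Set (ℕ → A)) {i : ℕ} (σ : Strategy T i) : Prop :=
  ∀ a ∈ plays σ, if i % 2 = 0 then a ∈ P else a ∉ P

/-- A game is determined if one of the two players has a winning strategy. -/
def Determined (T : Set (List A)) (P : Set (ℕ → A)) : Prop :=
  (∃ σ : Strategy T 0, WinningStrategy T P σ) ∨ ∃ σ : Strategy T 1, WinningStrategy T P σ

/-- The strategy tree of a functional strategy: all positions reachable while player `i`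
follows `σ`. -/
def stratTree (T : Set (List A)) (i : ℕ) (σ : Strategy T i) : Set (List A) :=
  {x ∈ T | ∀ (y : List A) (a : A), y ++ [a] <+: x → y.length % 2 = i % 2 → a = σ.move y}

/-- A morphism of trees: an isotone, length-preserving map. -/
structure TreeHom (S : Set (List A)) (T : Set (List B)) where
  toFun : List A → List B
  mem : ∀ x ∈ S, toFun x ∈ T
  len : ∀ x ∈ S, (toFun x).length = x.length
  mono : ∀ ⦃x y : List A⦄, x ∈ S → y ∈ S → x <+: y → toFun x <+: toFun y

/-- The identity tree morphism. -/
def TreeHom.id (S : Set (List A)) : TreeHom S S where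
  toFun := _root_.id
  mem _ hx := hx
  len _ _ := rfl
  mono _ _ _ _ h := h

/-- Composition of tree morphisms. -/
def TreeHom.comp {S : Set (List A)} {T : Set (List B)} {U : Set (List C)}
    (g : TreeHom T U) (f : TreeHom S T) : TreeHom S U where
  toFun := g.toFun ∘ f.toFun
  mem x hx := g.mem _ (f.mem x hx)
  len x hx := by simp only [Function.comp_apply, g.len _ (f.mem x hx), f.len x hx]
  mono x y hx hy hxy := g.mono (f.mem x hx) (f.mem y hy) (f.mono hx hy hxy)

/-- The map induced on infinite branches by a length-preserving isotone map of trees. -/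
def bodyMap [Inhabited B] (f : List A → List B) (a : ℕ → A) : ℕ → B :=
  fun n => (f (List.ofFn fun i : Fin (n + 1) => a i)).getD n default

/-- A covering of trees: a tree morphism `π` together with a map `φ` of strategies (of either
player) satisfying the locality condition and the branch lifting condition. -/
structure Covering [Inhabited A] (S : Set (List B)) (T : Set (List A)) where
  π : TreeHom S T
  φ : ∀ i : ℕ, Strategy S i → Strategy T i
  agree : ∀ (i n : ℕ) (σ σ' : Strategy S i),
    (∀ x ∈ S, x.length ≤ n → σ.move x = σ'.move x) →
    ∀ x ∈ T, x.length ≤ n → (φ i σ).move x = (φ i σ').move x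
  lift : ∀ (i : ℕ) (σ : Strategy S i), ∀ a ∈ plays (φ i σ),
    ∃ a' ∈ plays σ, bodyMap π.toFun a' = a

/-- A covering is `k`-fixing if `π` restricts to a bijection on the first `k` levels and `φ` is
induced by `π` there. -/
structure IsFixing [Inhabited A] {S : Set (List B)} {T : Set (List A)} (k : ℕ)
    (c : Covering S T) : Prop where
  bij : Function.Bijective fun x : {x : List B // x ∈ S ∧ x.length ≤ k} =>
    (⟨c.π.toFun x.1, c.π.mem _ x.2.1, by rw [c.π.len _ x.2.1]; exact x.2.2⟩ :
      {x : List A // x ∈ T ∧ x.length ≤ k})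
  induced : ∀ (i : ℕ) (σ : Strategy S i), ∀ x ∈ S, x.length < k → x.length % 2 = i % 2 →
    c.π.toFun (x ++ [σ.move x]) = c.π.toFun x ++ [(c.φ i σ).move (c.π.toFun x)]

/-- A game `(T, P)` is unravelable if for every `k` there is a `k`-fixing covering of `T` such
that the preimage of `P` is clopen in the body of the covering tree. -/
def Unravelable [Inhabited A] (T : Set (List A)) (P : Set (ℕ → A)) : Prop :=
  ∀ k : ℕ, ∃ (B : Type u) (S : Set (List B)) (c : Covering S T),
    IsTree S ∧ IsPruned S ∧ S.Nonempty ∧ IsFixing k c ∧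
    @IsClopen _ (bodyTop S) {a : {a // a ∈ body S} | bodyMap c.π.toFun a.1 ∈ P}

/-- A game `(T, P)` is universally unravelable if for every covering of `T` the game with the
preimage of `P` as payoff set is unravelable. -/
def UnivUnravelable [Inhabited A] (T : Set (List A)) (P : Set (ℕ → A)) : Prop :=
  ∀ (B : Type u) (_ : Inhabited B) (S : Set (List B)) (c : Covering S T),
    IsTree S → IsPruned S → S.Nonempty →
    Unravelable S (bodyMap c.π.toFun ⁻¹' P)

end GS

namespace GS

/-- A pruned forest of positions, graded by length, presented by its child relation. -/
structure PosTree where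
  Node : Type u
  len : Node → ℕ
  Ch : Node → Node → Prop
  ch_len : ∀ {x y}, Ch x y → len y = len x + 1
  ch_uniq : ∀ {x y z}, Ch x z → Ch y z → x = y
  pruned : ∀ x, ∃ y, Ch x y

namespace PosTree

/-- An infinite branch, given by its sequence of positions. -/
def IsBr (T : PosTree.{u}) (b : ℕ → T.Node) : Prop :=
  T.len (b 0) = 0 ∧ ∀ n, T.Ch (b n) (b (n + 1))

/-- A set of branches that is open in the space of branches. -/
def Op (T : PosTree.{u}) (P : Set (ℕ → T.Node)) : Prop :=
  ∃ D : Set T.Node, ∀ b, T.IsBr b → (b ∈ P ↔ ∃ n, b n ∈ D)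

/-- A legal move function, defined at the positions of both players. -/
def Leg (T : PosTree.{u}) (σ : T.Node → T.Node) : Prop := ∀ x, T.Ch x (σ x)

/-- Positions of length `n` belong to player `i`; `false` is the first player. -/
def Mv (i : Bool) (n : ℕ) : Prop := n % 2 = if i then 1 else 0

/-- The branches in which player `i` follows `σ`. -/
def Play (T : PosTree.{u}) (i : Bool) (σ : T.Node → T.Node) (b : ℕ → T.Node) : Prop :=
  T.IsBr b ∧ ∀ n, Mv i n → b (n + 1) = σ (b n)

/-- The initial-segment relation on positions. -/
def Le (T : PosTree.{u}) : T.Node → T.Node → Prop := Relation.ReflTransGen T.Ch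

variable {T : PosTree.{u}}

theorem IsBr.len {b : ℕ → T.Node} (hb : T.IsBr b) (n : ℕ) : T.len (b n) = n := by
  induction n with
  | zero => exact hb.1
  | succ n ih => rw [T.ch_len (hb.2 n), ih]

theorem Le.len {x y : T.Node} (h : T.Le x y) : T.len x ≤ T.len y := by
  induction h with
  | refl => rfl
  | tail _ h ih => have := T.ch_len h; omega

theorem Le.eq_of_len {x y : T.Node} (h : T.Le x y) (hl : T.len y ≤ T.len x) : x = y := by
  rcases Relation.ReflTransGen.cases_tail h with h | ⟨c, hc, h⟩
  · exact h.symm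
  · have := T.ch_len h
    have := Le.len hc
    omega

theorem IsBr.le {b : ℕ → T.Node} (hb : T.IsBr b) {m n : ℕ} (h : m ≤ n) : T.Le (b m) (b n) := by
  induction h with
  | refl => exact .refl
  | step _ ih => exact ih.tail (hb.2 _)

theorem IsBr.eq_of_le {b : ℕ → T.Node} (hb : T.IsBr b) {y : T.Node} {n : ℕ}
    (h : T.Le y (b n)) : y = b (T.len y) := by
  induction n with
  | zero =>
    have h1 := Le.len h
    rw [hb.len] at h1
    have := h.eq_of_len (by rw [hb.len]; omega)
    rw [Nat.le_zero.mp h1, this]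
  | succ n ih =>
    rcases Relation.ReflTransGen.cases_tail h with h' | ⟨c, hc, h'⟩
    · rw [← h', hb.len]
    · rw [T.ch_uniq h' (hb.2 n)] at hc
      exact ih hc

open Classical in
/-- A legal move function that selects moves satisfying `Q` whenever there are some. -/
noncomputable def pick (T : PosTree.{u}) (Q : T.Node → T.Node → Prop) (x : T.Node) : T.Node :=
  if h : ∃ y, T.Ch x y ∧ Q x y then h.choose else (T.pruned x).choose

theorem leg_pick (Q : T.Node → T.Node → Prop) : T.Leg (T.pick Q) := by
  intro x
  unfold pick
  split_ifs with h
  exacts [h.choose_spec.1, (T.pruned x).choose_spec]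

theorem pick_spec {Q : T.Node → T.Node → Prop} {x y : T.Node} (h : T.Ch x y) (hQ : Q x y) :
    Q x (T.pick Q x) := by
  have h' : ∃ y, T.Ch x y ∧ Q x y := ⟨y, h, hQ⟩
  rw [pick, dif_pos h']
  exact h'.choose_spec.2

end PosTree

open PosTree

section Reach

variable {X : Type u} (R : X → X → Prop) (j : X → Prop) (U : Set X)

/-- The positions from which the player moving at `j` forces a visit to `U`, with a rank bound. -/
inductive ForceRank : Ordinal.{u} → X → Prop
  | base {a x} : x ∈ U → ForceRank a x
  | mine {a b x y} : j x → R x y → b < a → ForceRank b y → ForceRank a x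
  | other {a x} (f : X → Ordinal.{u}) : ¬ j x → (∀ y, R x y → f y < a) →
      (∀ y, R x y → ForceRank (f y) y) → ForceRank a x

/-- `W` is the region from which the player moving at `j` can force a visit to `U` along `R`,
with the rank function `r` decreasing until `U` is reached. -/
structure IsReach (W : Set X) (r : X → Ordinal.{u}) : Prop where
  sub : U ⊆ W
  mine_in : ∀ x ∈ W, x ∉ U → j x → ∃ y, R x y ∧ y ∈ W ∧ r y < r x
  other_in : ∀ x ∈ W, x ∉ U → ¬ j x → ∀ y, R x y → y ∈ W ∧ r y < r x
  mine_out : ∀ x ∉ W, j x → ∀ y, R x y → y ∉ W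
  other_out : ∀ x ∉ W, ¬ j x → ∃ y, R x y ∧ y ∉ W

theorem exists_isReach : ∃ W r, IsReach R j U W r := by
  have key : ∀ x, (∃ a, ForceRank R j U a x) → ForceRank R j U (sInf {a | ForceRank R j U a x}) x :=
    fun x h => csInf_mem (s := {a | ForceRank R j U a x}) h
  have low : ∀ x a, ForceRank R j U a x → sInf {a | ForceRank R j U a x} ≤ a :=
    fun x a h => csInf_le' h
  refine ⟨{x | ∃ a, ForceRank R j U a x}, fun x => sInf {a | ForceRank R j U a x},
    fun x hx => ⟨0, .base hx⟩, ?_, ?_, ?_, ?_⟩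
  · intro x hx hU hj
    cases key x hx with
    | base h => exact absurd h hU
    | mine _ hR hlt h => exact ⟨_, hR, ⟨_, h⟩, (low _ _ h).trans_lt hlt⟩
    | other f h => exact absurd hj h
  · intro x hx hU hj y hy
    cases key x hx with
    | base h => exact absurd h hU
    | mine h => exact absurd h hj
    | other f _ h1 h2 => exact ⟨⟨_, h2 y hy⟩, (low _ _ (h2 y hy)).trans_lt (h1 y hy)⟩
  · rintro x hx hj y hy ⟨a, ha⟩
    exact hx ⟨_, .mine hj hy (Order.lt_succ a) ha⟩
  · intro x hx hj
    by_contra! hc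
    refine hx ⟨⨆ y : X, Order.succ (sInf {a | ForceRank R j U a y}), .other _ hj (fun y hy => ?_)
      (fun y hy => key y (hc y hy))⟩
    exact (Order.lt_succ _).trans_le (Ordinal.le_iSup
      (fun y : X => Order.succ (sInf {a | ForceRank R j U a y})) y)

theorem notMem_of_descent {W : Set X} {r : X → Ordinal.{u}} {b : ℕ → X} {N : ℕ}
    (step : ∀ m, N ≤ m → b m ∈ W → b (m + 1) ∈ W ∧ r (b (m + 1)) < r (b m)) :
    ∀ m, N ≤ m → b m ∉ W := by
  intro m hm hW
  have hin : ∀ n, b (m + n) ∈ W := fun n => by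
    induction n with
    | zero => exact hW
    | succ n ih => exact (step _ (by omega) ih).1
  exact not_strictAnti_of_wellFoundedLT (fun n => r (b (m + n)))
    (strictAnti_nat_of_succ_lt fun n => (step _ (by omega) (hin n)).2)

end Reach

namespace PosTree

/-- Open games are determined from each starting position. -/
theorem open_determined (T : PosTree.{u}) (P : Set (ℕ → T.Node)) (hP : T.Op P) (x₀ : T.Node)
    (i : Bool) :
    (∃ σ, T.Leg σ ∧ ∀ b, T.Play i σ b → b 0 = x₀ → b ∈ P) ∨
    (∃ σ, T.Leg σ ∧ ∀ b, T.Play (!i) σ b → b 0 = x₀ → b ∉ P) := by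
  obtain ⟨D, hD⟩ := hP
  obtain ⟨W, r, hW⟩ := exists_isReach T.Ch (fun x => Mv i (T.len x)) D
  by_cases h0 : x₀ ∈ W
  · left
    refine ⟨T.pick fun x y => y ∈ W ∧ r y < r x, leg_pick _, fun b hb hb0 => ?_⟩
    rw [hD b hb.1]
    by_contra! hc
    refine notMem_of_descent (N := 0) (b := b) (r := r) (W := W) (fun n _ hn => ?_) 0 le_rfl
      (hb0 ▸ h0)
    by_cases hm : Mv i n
    · obtain ⟨y, hy, hQ⟩ := hW.mine_in _ hn (hc n) (by rwa [hb.1.len])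
      rw [hb.2 n hm]
      exact pick_spec (Q := fun x y => y ∈ W ∧ r y < r x) hy hQ
    · exact hW.other_in _ hn (hc n) (by rwa [hb.1.len]) _ (hb.1.2 n)
  · right
    refine ⟨T.pick fun _ y => y ∉ W, leg_pick _, fun b hb hb0 => ?_⟩
    rw [hD b hb.1]
    rintro ⟨n, hn⟩
    have hout : ∀ n, b n ∉ W := fun n => by
      induction n with
      | zero => rwa [hb0]
      | succ n ih =>
        by_cases hm : Mv i n
        · exact hW.mine_out _ ih (by rwa [hb.1.len]) _ (hb.1.2 n)
        · obtain ⟨y, hy, hQ⟩ := hW.other_out _ ih (by rwa [hb.1.len])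
          rw [hb.2 n (by unfold Mv at *; cases i <;> simp_all)]
          exact pick_spec (Q := fun _ y => y ∉ W) hy hQ
    exact hout n (hW.sub hn)

end PosTree

/-- A length-preserving map of trees of positions. -/
structure PosHom (S T : PosTree.{u}) where
  f : S.Node → T.Node
  len : ∀ x, T.len (f x) = S.len x
  ch : ∀ {x y}, S.Ch x y → T.Ch (f x) (f y)

/-- The preimage of a payoff set. -/
def PosHom.pre {S T : PosTree.{u}} (c : PosHom S T) (P : Set (ℕ → T.Node)) : Set (ℕ → S.Node) :=
  {b | (fun n => c.f (b n)) ∈ P}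

theorem PosHom.isBr {S T : PosTree.{u}} (c : PosHom S T) {b : ℕ → S.Node} (hb : S.IsBr b) :
    T.IsBr fun n => c.f (b n) :=
  ⟨by rw [c.len, hb.1], fun n => c.ch (hb.2 n)⟩

theorem PosHom.op_pre {S T : PosTree.{u}} (c : PosHom S T) {P : Set (ℕ → T.Node)} (hP : T.Op P) :
    S.Op (c.pre P) := by
  obtain ⟨D, hD⟩ := hP
  exact ⟨c.f ⁻¹' D, fun b hb => hD _ (c.isBr hb)⟩

/-- The composition of maps of trees of positions. -/
def PosHom.comp {S T V : PosTree.{u}} (c : PosHom T V) (d : PosHom S T) : PosHom S V where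
  f := c.f ∘ d.f
  len x := by rw [Function.comp_apply, c.len, d.len]
  ch h := c.ch (d.ch h)

/-- The identity map. -/
def PosHom.refl (T : PosTree.{u}) : PosHom T T := ⟨_root_.id, fun _ => rfl, fun h => h⟩

/-- A covering: strategies upstairs are sent to strategies downstairs, locally in the length, in
such a way that plays lift. -/
structure PosCov (S T : PosTree.{u}) extends PosHom S T where
  φ : Bool → (S.Node → S.Node) → T.Node → T.Node
  leg : ∀ i σ, S.Leg σ → T.Leg (φ i σ)
  loc : ∀ i σ τ, S.Leg σ → S.Leg τ → ∀ x, (∀ y, S.len y ≤ T.len x → σ y = τ y) →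
    φ i σ x = φ i τ x
  lift : ∀ i σ, S.Leg σ → ∀ b, T.Play i (φ i σ) b → ∃ b', S.Play i σ b' ∧ ∀ n, f (b' n) = b n

/-- The composition of coverings. -/
def PosCov.comp {S T V : PosTree.{u}} (c : PosCov T V) (d : PosCov S T) : PosCov S V where
  toPosHom := c.toPosHom.comp d.toPosHom
  φ i σ := c.φ i (d.φ i σ)
  leg i σ h := c.leg i _ (d.leg i σ h)
  loc i σ τ hσ hτ x h := c.loc i _ _ (d.leg i σ hσ) (d.leg i τ hτ) x fun y hy =>
    d.loc i σ τ hσ hτ y fun z hz => h z (hz.trans hy)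
  lift i σ hσ b hb := by
    obtain ⟨b', hb', h'⟩ := c.lift i _ (d.leg i σ hσ) b hb
    obtain ⟨b'', hb'', h''⟩ := d.lift i σ hσ b' hb'
    exact ⟨b'', hb'', fun n => (congrArg c.f (h'' n)).trans (h' n)⟩

/-- The covering is an isomorphism on positions of length at most `k`, strategies included. -/
structure PosCov.Fix {S T : PosTree.{u}} (k : ℕ) (c : PosCov S T) : Prop where
  inj : ∀ x y, S.len x ≤ k → S.len y ≤ k → c.f x = c.f y → x = y
  surj : ∀ y, T.len y ≤ k → ∃ x, c.f x = y
  refl : ∀ x y, S.len y ≤ k → T.Ch (c.f x) (c.f y) → S.Ch x y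
  ind : ∀ i σ, S.Leg σ → ∀ x, S.len x < k → c.φ i σ (c.f x) = c.f (σ x)

theorem PosCov.Fix.comp {S T V : PosTree.{u}} {k : ℕ} {c : PosCov T V} {d : PosCov S T}
    (hc : c.Fix k) (hd : d.Fix k) : (c.comp d).Fix k where
  inj x y hx hy h := hd.inj x y hx hy
    (hc.inj _ _ (by rwa [d.len]) (by rwa [d.len]) h)
  surj y hy := by
    obtain ⟨z, rfl⟩ := hc.surj y hy
    obtain ⟨x, rfl⟩ := hd.surj z (by rwa [c.len] at hy)
    exact ⟨x, rfl⟩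
  refl x y hy h := hd.refl x y hy (hc.refl _ _ (by rwa [d.len]) h)
  ind i σ hσ x hx := by
    refine (hc.ind i _ (d.leg i σ hσ) _ (by rwa [d.len])).trans ?_
    exact congrArg c.f (hd.ind i σ hσ x hx)

/-- Coverings fixing arbitrarily long initial parts make the payoff set clopen. -/
def Unravels (T : PosTree.{u}) (P : Set (ℕ → T.Node)) : Prop :=
  ∀ k, ∃ (S : PosTree.{u}) (c : PosCov S T), c.Fix k ∧ S.Op (c.pre P) ∧ S.Op (c.pre P)ᶜ

section Limit

theorem forall_of_up_down {Q : ℕ → Prop} (n : ℕ) (h : Q n) (down : ∀ m, Q (m + 1) → Q m)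
    (up : ∀ m, n ≤ m → Q m → Q (m + 1)) (m : ℕ) : Q m := by
  rcases le_total n m with hm | hm
  · exact Nat.le_induction h up m hm
  · exact Nat.decreasingInduction (fun k _ => down k) h hm

/-- Threads of positions along a sequence of coverings. -/
def Thread (X : ℕ → PosTree.{u}) (c : ∀ n, PosCov (X (n + 1)) (X n)) : Type u :=
  {x : ∀ n, (X n).Node // ∀ n, (c n).f (x (n + 1)) = x n}

theorem Thread.exists_eq (n : ℕ) : ∀ (X : ℕ → PosTree.{u}) (c : ∀ n, PosCov (X (n + 1)) (X n))
    (K : ℕ), (∀ n, (c n).Fix (K + n)) → ∀ y, (X n).len y ≤ K + n →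
      ∃ x : Thread X c, x.1 n = y := by
  induction n with
  | zero =>
    intro X c K hc y hy
    have up : ∀ n (z : {z // (X n).len z = (X 0).len y}),
        ∃ w : {w // (X (n + 1)).len w = (X 0).len y}, (c n).f w = z := by
      rintro n ⟨z, hz⟩
      obtain ⟨w, rfl⟩ := (hc n).surj z (by omega)
      exact ⟨⟨w, by rw [← (c n).len, hz]⟩, rfl⟩
    choose g hg using up
    let x : ∀ n, {z // (X n).len z = (X 0).len y} := fun n => Nat.rec ⟨y, rfl⟩ g n
    exact ⟨⟨fun n => (x n).1, fun n => hg n (x n)⟩, rfl⟩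
  | succ n ih =>
    intro X c K hc y hy
    obtain ⟨x, hx⟩ := ih (fun m => X (m + 1)) (fun m => c (m + 1)) (K + 1)
      (fun m => by convert hc (m + 1) using 1; omega) y (by omega)
    exact ⟨⟨fun | 0 => (c 0).f (x.1 0) | m + 1 => x.1 m, fun | 0 => rfl | m + 1 => x.2 m⟩, hx⟩

variable {X : ℕ → PosTree.{u}} {c : ∀ n, PosCov (X (n + 1)) (X n)} {K : ℕ}

theorem Thread.len (x : Thread X c) (n : ℕ) : (X n).len (x.1 n) = (X 0).len (x.1 0) := by
  induction n with
  | zero => rfl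
  | succ n ih => rw [← ih, ← x.2 n, (c n).len]

theorem Thread.ext_of_eq (hc : ∀ n, (c n).Fix (K + n)) {x y : Thread X c} {n : ℕ}
    (hx : (X n).len (x.1 n) ≤ K + n) (h : x.1 n = y.1 n) : x = y := by
  refine Subtype.ext (funext (forall_of_up_down n h (fun m hm => ?_) fun m hm ih => ?_))
  · rw [← x.2, ← y.2, hm]
  · have hl := x.len n
    have hl' := x.len m
    refine (hc m).inj _ _ ?_ ?_ (by rw [x.2, y.2, ih])
    · rw [← (c m).len, x.2]; omega
    · rw [← (c m).len, y.2, ← ih]; omega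

theorem Thread.ch_of_ch (hc : ∀ n, (c n).Fix (K + n)) {x y : Thread X c} {n : ℕ}
    (hy : (X n).len (y.1 n) ≤ K + n) (h : (X n).Ch (x.1 n) (y.1 n)) (m : ℕ) :
    (X m).Ch (x.1 m) (y.1 m) := by
  refine forall_of_up_down (Q := fun m => (X m).Ch (x.1 m) (y.1 m)) n h (fun m hm => ?_)
    (fun m hm ih => ?_) m
  · rw [← x.2, ← y.2]
    exact (c m).ch hm
  · have hl := y.len n
    have hl' := y.len (m + 1)
    refine (hc m).refl _ _ (by omega) (by rwa [x.2, y.2])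

/-- The inverse limit of a sequence of trees of positions. -/
def limTree (hc : ∀ n, (c n).Fix (K + n)) : PosTree.{u} where
  Node := Thread X c
  len x := (X 0).len (x.1 0)
  Ch x y := ∀ n, (X n).Ch (x.1 n) (y.1 n)
  ch_len h := (X 0).ch_len (h 0)
  ch_uniq h h' := Subtype.ext (funext fun n => (X n).ch_uniq (h n) (h' n))
  pruned x := by
    set n := (X 0).len (x.1 0) + 1 with hn
    obtain ⟨z, hz⟩ := (X n).pruned (x.1 n)
    have hl := (X n).ch_len hz
    rw [x.len] at hl
    obtain ⟨y, rfl⟩ := Thread.exists_eq n X c K hc z (by omega)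
    exact ⟨y, Thread.ch_of_ch hc (by omega) hz⟩

/-- The projections from the inverse limit. -/
def limHom (hc : ∀ n, (c n).Fix (K + n)) (n : ℕ) : PosHom (limTree hc) (X n) where
  f x := x.1 n
  len x := x.len n
  ch h := h n

open Classical in
/-- The strategy on the `n`-th tree that copies a strategy on the limit at short positions. -/
noncomputable def copyStrat (K : ℕ) (σ : Thread X c → Thread X c) (n : ℕ) (y : (X n).Node) :
    (X n).Node :=
  if h : (X n).len y < K + n ∧ ∃ x : Thread X c, x.1 n = y then (σ h.2.choose).1 n
  else (X n).pick (fun _ _ => True) y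

theorem copyStrat_eq (hc : ∀ n, (c n).Fix (K + n)) (σ : Thread X c → Thread X c) {n : ℕ}
    (x : Thread X c) (hx : (X n).len (x.1 n) < K + n) :
    copyStrat K σ n (x.1 n) = (σ x).1 n := by
  have h : (X n).len (x.1 n) < K + n ∧ ∃ x' : Thread X c, x'.1 n = x.1 n := ⟨hx, x, rfl⟩
  rw [copyStrat, dif_pos h, ← Thread.ext_of_eq hc hx.le h.2.choose_spec.symm]

theorem leg_copyStrat (hc : ∀ n, (c n).Fix (K + n)) {σ : Thread X c → Thread X c}
    (hσ : (limTree hc).Leg σ) (n : ℕ) : (X n).Leg (copyStrat K σ n) := by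
  intro y
  by_cases h : (X n).len y < K + n ∧ ∃ x : Thread X c, x.1 n = y
  · obtain ⟨h, x, rfl⟩ := h
    rw [copyStrat_eq hc σ x h]
    exact hσ x n
  · rw [copyStrat, dif_neg h]
    exact leg_pick _ y

/-- The `j`-fold image of the copying strategy on the `(n + j)`-th tree. -/
noncomputable def approxStrat (K : ℕ) (i : Bool) (σ : Thread X c → Thread X c) :
    ℕ → ∀ n, (X n).Node → (X n).Node
  | 0, n => copyStrat K σ n
  | j + 1, n => (c n).φ i (approxStrat K i σ j (n + 1))

/-- The strategy induced on the `n`-th tree by a strategy on the limit. -/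
noncomputable def limStrat (K : ℕ) (i : Bool) (σ : Thread X c → Thread X c) (n : ℕ)
    (x : (X n).Node) : (X n).Node :=
  approxStrat K i σ ((X n).len x + 1) n x

variable (hc : ∀ n, (c n).Fix (K + n)) (i : Bool) {σ : Thread X c → Thread X c}
  (hσ : (limTree hc).Leg σ)

include hσ

theorem leg_approxStrat (j : ℕ) : ∀ n, (X n).Leg (approxStrat K i σ j n) := by
  induction j with
  | zero => exact leg_copyStrat hc hσ
  | succ j ih => exact fun n => (c n).leg i _ (ih (n + 1))

theorem approxStrat_succ (j : ℕ) : ∀ n x, (X n).len x < K + n + j →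
    approxStrat K i σ (j + 1) n x = approxStrat K i σ j n x := by
  induction j with
  | zero =>
    intro n x hx
    obtain ⟨y, rfl⟩ := Thread.exists_eq n X c K hc x (by omega)
    have hl : (X (n + 1)).len (y.1 (n + 1)) < K + n := by
      rw [← (c n).len, y.2]; exact hx
    show (c n).φ i (copyStrat K σ (n + 1)) _ = copyStrat K σ n _
    rw [copyStrat_eq hc σ y hx]
    conv_lhs => rw [← y.2 n]
    rw [(hc n).ind i _ (leg_copyStrat hc hσ _) _ hl, copyStrat_eq hc σ y (by omega), (σ y).2]
  | succ j ih =>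
    intro n x hx
    exact (c n).loc i _ _ (leg_approxStrat hc i hσ _ _) (leg_approxStrat hc i hσ _ _) x
      fun y hy => ih _ y (by omega)

theorem approxStrat_eq {j n : ℕ} {x : (X n).Node} (hx : (X n).len x < K + n + j) :
    approxStrat K i σ j n x = limStrat K i σ n x := by
  have key : ∀ a b, (X n).len x < K + n + a → a ≤ b →
      approxStrat K i σ b n x = approxStrat K i σ a n x := by
    intro a b ha hab
    induction b, hab using Nat.le_induction with
    | base => rfl
    | succ b hab ih => rw [approxStrat_succ hc i hσ b n x (by omega), ih]
  rcases le_total j ((X n).len x + 1) with h | h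
  · exact (key _ _ hx h).symm
  · exact key _ _ (by omega) h

theorem leg_limStrat (n : ℕ) : (X n).Leg (limStrat K i σ n) :=
  fun x => leg_approxStrat hc i hσ _ n x

theorem φ_limStrat (n : ℕ) : (c n).φ i (limStrat K i σ (n + 1)) = limStrat K i σ n := by
  funext x
  rw [← approxStrat_eq hc i hσ (j := (X n).len x + 1) (by omega)]
  exact (c n).loc i _ _ (leg_limStrat hc i hσ _) (leg_approxStrat hc i hσ _ _) x
    fun y hy => (approxStrat_eq hc i hσ (by omega)).symm

theorem limStrat_eq {n : ℕ} (x : Thread X c) (hx : (X n).len (x.1 n) < K + n) :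
    limStrat K i σ n (x.1 n) = (σ x).1 n := by
  rw [← approxStrat_eq hc i hσ (j := 0) (by omega)]
  exact copyStrat_eq hc σ x hx

omit hσ

/-- The inverse limit covers the first tree. -/
noncomputable def limCov : PosCov (limTree hc) (X 0) where
  toPosHom := limHom hc 0
  φ i σ := limStrat K i σ 0
  leg i σ hσ := leg_limStrat hc i hσ 0
  loc i σ τ hσ hτ x h := by
    have key : ∀ j n x', (X n).len x' ≤ (X 0).len x →
        approxStrat K i σ j n x' = approxStrat K i τ j n x' := by
      intro j
      induction j with
      | zero =>
        intro n y hy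
        by_cases hn : (X n).len y < K + n ∧ ∃ x : Thread X c, x.1 n = y
        · obtain ⟨hn, z, rfl⟩ := hn
          show copyStrat K σ n _ = copyStrat K τ n _
          rw [copyStrat_eq hc σ z hn, copyStrat_eq hc τ z hn, h z]
          show (X 0).len (z.1 0) ≤ _
          rw [← z.len n]
          exact hy
        · show copyStrat K σ n _ = copyStrat K τ n _
          simp only [copyStrat, dif_neg hn]
      | succ j ih =>
        intro n y hy
        exact (c n).loc i _ _ (leg_approxStrat hc i hσ _ _) (leg_approxStrat hc i hτ _ _) y
          fun z hz => ih _ z (hz.trans hy)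
    exact key _ 0 x le_rfl
  lift i σ hσ b hb := by
    have step : ∀ n (b : {b // (X n).Play i (limStrat K i σ n) b}),
        ∃ b' : {b // (X (n + 1)).Play i (limStrat K i σ (n + 1)) b},
          ∀ m, (c n).f (b'.1 m) = b.1 m := by
      rintro n ⟨b, hb⟩
      rw [← φ_limStrat hc i hσ] at hb
      obtain ⟨b', hb', h⟩ := (c n).lift i _ (leg_limStrat hc i hσ _) b hb
      exact ⟨⟨b', hb'⟩, h⟩
    choose g hg using step
    let B : ∀ n, {b // (X n).Play i (limStrat K i σ n) b} := fun n => Nat.rec ⟨b, hb⟩ g n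
    let b' : ℕ → Thread X c := fun m => ⟨fun n => (B n).1 m, fun n => hg n (B n) m⟩
    refine ⟨b', ⟨⟨(B 0).2.1.1, fun m n => (B n).2.1.2 m⟩, fun m hm => ?_⟩, fun n => rfl⟩
    have hl : (X (m + 1)).len ((B (m + 1)).1 m) = m := (B (m + 1)).2.1.len m
    refine Thread.ext_of_eq hc (n := m + 1) ?_ ?_
    · exact ((B (m + 1)).2.1.len (m + 1)).trans_le (by omega)
    · refine ((B (m + 1)).2.2 m hm).trans ?_
      exact limStrat_eq hc i hσ (b' m) (hl.trans_lt (by omega))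

theorem limCov_fix : (limCov hc).Fix K where
  inj _ _ hx _ h := Thread.ext_of_eq hc (n := 0) hx h
  surj y hy := Thread.exists_eq 0 X c K hc y hy
  refl _ _ hy h := Thread.ch_of_ch hc (n := 0) hy h
  ind i _ hσ x hx := limStrat_eq hc i hσ x hx

end Limit

section Closed

variable {T : PosTree.{u}}

theorem PosTree.not_mv {i : Bool} {n : ℕ} : ¬ Mv i n ↔ Mv (!i) n := by
  cases i <;> simp [Mv]

theorem PosTree.Le.unique {x y z : T.Node} (hx : T.Le x z) (hy : T.Le y z)
    (h : T.len x = T.len y) : x = y := by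
  induction hx generalizing y with
  | refl => exact (hy.eq_of_len h.le).symm
  | @tail c z hx hc ih =>
    rcases Relation.ReflTransGen.cases_tail hy with rfl | ⟨d, hd, hd'⟩
    · have := Le.len hx
      have := T.ch_len hc
      omega
    · rw [T.ch_uniq hd' hc] at hd
      exact ih hd h

/-- The positions comparable to `u`. -/
def cone (u : T.Node) : Set T.Node := {y | T.Le y u ∨ T.Le u y}

theorem exists_ch_mem_cone {x u : T.Node} (hx : x ∈ cone u) : ∃ y, T.Ch x y ∧ y ∈ cone u := by
  rcases hx with h | h
  · rcases Relation.ReflTransGen.cases_head h with rfl | ⟨c, hc, h⟩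
    · obtain ⟨y, hy⟩ := T.pruned x
      exact ⟨y, hy, .inr (.single hy)⟩
    · exact ⟨c, hc, .inl h⟩
  · obtain ⟨y, hy⟩ := T.pruned x
    exact ⟨y, hy, .inr (h.tail hy)⟩

theorem le_of_mem_cone {y u : T.Node} (hy : y ∈ cone u) (h : T.len y ≤ T.len u) : T.Le y u := by
  rcases hy with hy | hy
  · exact hy
  · rw [hy.eq_of_len h]
    exact .refl

theorem PosTree.IsBr.mem_cone {b : ℕ → T.Node} (hb : T.IsBr b) (m n : ℕ) : b m ∈ cone (b n) :=
  (le_total m n).imp hb.le hb.le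

theorem PosTree.IsBr.eq_of_mem_cone {b : ℕ → T.Node} (hb : T.IsBr b) {y : T.Node} {n : ℕ}
    (hy : y ∈ cone (b n)) (h : T.len y ≤ n) : y = b (T.len y) :=
  hb.eq_of_le (le_of_mem_cone hy (by rwa [hb.len]))

/-- `u` is the first initial segment of `x` that lies in `A`. -/
def IsFirst (A : Set T.Node) (u x : T.Node) : Prop :=
  T.Le u x ∧ u ∈ A ∧ ∀ v, T.Le v u → v ∈ A → v = u

/-- The set `F u` if `u` is the first initial segment of `x` in `A`, and `D` if there is none. -/
def byFirst (A : Set T.Node) (F : T.Node → Set T.Node) (D : Set T.Node) (x : T.Node) :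
    Set T.Node :=
  {y | (∃ u, IsFirst A u x ∧ y ∈ F u) ∨ ((¬ ∃ u, IsFirst A u x) ∧ y ∈ D)}

theorem PosTree.IsBr.isFirst_iff {b : ℕ → T.Node} (hb : T.IsBr b) {A : Set T.Node} {n : ℕ}
    (hn : b n ∈ A) (hmin : ∀ k < n, b k ∉ A) {u : T.Node} {m : ℕ} :
    IsFirst A u (b m) ↔ u = b n ∧ n ≤ m := by
  constructor
  · rintro ⟨h1, h2, h3⟩
    have hu := hb.eq_of_le h1
    have hl : T.len u ≤ m := by simpa [hb.len] using Le.len h1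
    have hnu : n ≤ T.len u := by
      by_contra hc
      exact hmin _ (not_le.mp hc) (hu ▸ h2)
    exact ⟨(h3 _ (hu ▸ hb.le hnu) hn).symm, hnu.trans hl⟩
  · rintro ⟨rfl, h⟩
    refine ⟨hb.le h, hn, fun v hv hvA => ?_⟩
    have hu := hb.eq_of_le hv
    have hl : T.len v ≤ n := by simpa [hb.len] using Le.len hv
    rcases hl.lt_or_eq with hl | hl
    · exact absurd (hu ▸ hvA) (hmin _ hl)
    · rw [hu, hl]

theorem PosTree.IsBr.byFirst_eq {b : ℕ → T.Node} (hb : T.IsBr b) {A : Set T.Node} {n : ℕ}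
    (hn : b n ∈ A) (hmin : ∀ k < n, b k ∉ A) {m : ℕ} (h : n ≤ m) (F : T.Node → Set T.Node)
    (D : Set T.Node) : byFirst A F D (b m) = F (b n) := by
  ext y
  simp [byFirst, hb.isFirst_iff hn hmin, h]

theorem PosTree.IsBr.byFirst_eq_of_notMem {b : ℕ → T.Node} (hb : T.IsBr b) {A : Set T.Node}
    (hA : ∀ k, b k ∉ A) (m : ℕ) (F : T.Node → Set T.Node) (D : Set T.Node) :
    byFirst A F D (b m) = D := by
  have : ∀ u, ¬ IsFirst A u (b m) := fun u h => hA _ (hb.eq_of_le h.1 ▸ h.2.1)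
  ext y
  simp [byFirst, this]

/-- The positions with no initial segment of length at least `N` in `W`. -/
def avoid (W : Set T.Node) (N : ℕ) : Set T.Node := {y | ∀ v, T.Le v y → N ≤ T.len v → v ∉ W}

theorem mem_avoid_of_ch {W : Set T.Node} {N : ℕ} {x y : T.Node} (hx : x ∈ avoid W N)
    (h : T.Ch x y) (hy : y ∉ W) : y ∈ avoid W N := by
  intro v hv hN
  rcases Relation.ReflTransGen.cases_tail hv with rfl | ⟨c, hc, hc'⟩
  · exact hy
  · rw [T.ch_uniq hc' h] at hc
    exact hx v hc hN

theorem notMem_of_mem_avoid {W : Set T.Node} {N : ℕ} {x : T.Node} (hx : x ∈ avoid W N)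
    (h : N ≤ T.len x) : x ∉ W := hx x .refl h

theorem PosTree.IsBr.mem_avoid {b : ℕ → T.Node} (hb : T.IsBr b) {W : Set T.Node} {N m : ℕ}
    (h : ∀ k, N ≤ k → k ≤ m → b k ∉ W) : b m ∈ avoid W N := by
  intro v hv hN
  rw [hb.eq_of_le hv]
  exact h _ hN (by simpa [hb.len] using Le.len hv)

variable (K : ℕ) (E : Set T.Node)

/-- A quasistrategy of the first player from length `K + 1` on. -/
structure QuasiI (S : Set T.Node) : Prop where
  one : ∀ x ∈ S, K + 1 ≤ T.len x → Mv false (T.len x) → ∃ y, T.Ch x y ∧ y ∈ S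
  all : ∀ x ∈ S, K + 1 ≤ T.len x → Mv true (T.len x) → ∀ y, T.Ch x y → y ∈ S

/-- A quasistrategy of the second player inside `S`, from length `K + 2` on, that avoids `E`. -/
structure QuasiII (S O : Set T.Node) : Prop where
  sub : O ⊆ S
  disj : ∀ x ∈ O, x ∉ E
  one : ∀ x ∈ O, K + 2 ≤ T.len x → Mv true (T.len x) → ∃ y, T.Ch x y ∧ y ∈ O
  all : ∀ x ∈ O, K + 2 ≤ T.len x → Mv false (T.len x) → ∀ y, T.Ch x y → y ∈ S → y ∈ O

theorem quasiI_univ : QuasiI K (Set.univ : Set T.Node) where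
  one x _ _ _ := (T.pruned x).imp fun _ h => ⟨h, trivial⟩
  all _ _ _ _ _ _ := trivial

variable {K E} in
theorem quasiII_avoid {S W : Set T.Node} {r : T.Node → Ordinal.{u}}
    (hE : ∀ x ∈ E, K + 2 ≤ T.len x)
    (hW : IsReach (fun x y => T.Ch x y ∧ y ∈ S) (fun x => Mv false (T.len x)) (S ∩ E) W r) :
    QuasiII K E S (S ∩ avoid W (K + 2)) where
  sub := Set.inter_subset_left
  disj x hx hxE := notMem_of_mem_avoid hx.2 (hE x hxE) (hW.sub ⟨hx.1, hxE⟩)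
  one x hx hl hm := by
    obtain ⟨y, ⟨hy, hyS⟩, hyW⟩ := hW.other_out x (notMem_of_mem_avoid hx.2 hl) (not_mv.mpr hm)
    exact ⟨y, hy, hyS, mem_avoid_of_ch hx.2 hy hyW⟩
  all x hx hl hm y hy hyS := ⟨hyS, mem_avoid_of_ch hx.2 hy
    (hW.mine_out x (notMem_of_mem_avoid hx.2 hl) hm y ⟨hy, hyS⟩)⟩

theorem quasiI_avoid {U W : Set T.Node} {r : T.Node → Ordinal.{u}}
    (hW : IsReach T.Ch (fun x => Mv true (T.len x)) U W r) : QuasiI K (avoid W (K + 1)) where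
  one x hx hl hm := by
    obtain ⟨y, hy, hyW⟩ := hW.other_out x (notMem_of_mem_avoid hx hl) (not_mv.mpr hm)
    exact ⟨y, hy, mem_avoid_of_ch hx hy hyW⟩
  all x hx hl hm y hy := mem_avoid_of_ch hx hy
    (hW.mine_out x (notMem_of_mem_avoid hx hl) hm y hy)

/-- The second player answers `S` either by naming a position of `S` in `E`, or by a
quasistrategy inside `S` avoiding `E`. -/
def Answer (S O : Set T.Node) : Prop := (∃ u ∈ S, u ∈ E ∧ O = cone u) ∨ QuasiII K E S O

/-- The positions of the auxiliary game: a position of `T`, the quasistrategy played by the first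
player at length `K`, and the answer of the second player. -/
structure Valid (p : T.Node × Set T.Node × Set T.Node) : Prop where
  triv₁ : T.len p.1 ≤ K → p.2.1 = Set.univ
  triv₂ : T.len p.1 ≤ K + 1 → p.2.2 = Set.univ
  quasi : QuasiI K p.2.1
  mem₁ : T.len p.1 = K + 1 → p.1 ∈ p.2.1
  answer : K + 2 ≤ T.len p.1 → Answer K E p.2.1 p.2.2
  mem₂ : K + 2 ≤ T.len p.1 → p.1 ∈ p.2.2

variable {K E} in
theorem Valid.of_le {x : T.Node} (h : T.len x ≤ K) : Valid K E (x, Set.univ, Set.univ) where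
  triv₁ _ := rfl
  triv₂ _ := rfl
  quasi := quasiI_univ K
  mem₁ _ := trivial
  answer h' := by dsimp only at h'; omega
  mem₂ _ := trivial

variable {K E} in
theorem Valid.of_eq {x : T.Node} {S : Set T.Node} (h : T.len x = K + 1) (hS : QuasiI K S)
    (hx : x ∈ S) : Valid K E (x, S, Set.univ) where
  triv₁ h' := by dsimp only at h'; omega
  triv₂ _ := rfl
  quasi := hS
  mem₁ _ := hx
  answer h' := by dsimp only at h'; omega
  mem₂ _ := trivial

variable {K E} in
theorem Valid.of_ge {x : T.Node} {S O : Set T.Node} (h : K + 2 ≤ T.len x) (hS : QuasiI K S)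
    (hO : Answer K E S O) (hx : x ∈ O) : Valid K E (x, S, O) where
  triv₁ h' := by dsimp only at h'; omega
  triv₂ h' := by dsimp only at h'; omega
  quasi := hS
  mem₁ h' := by dsimp only at h'; omega
  answer _ := hO
  mem₂ _ := hx

/-- The set `S`, forgotten at lengths at most `k`. -/
def trunc {X : Type u} (k : ℕ) (S : Set X) (n : ℕ) : Set X := {x | k < n → x ∈ S}

theorem trunc_of_le {X : Type u} {k n : ℕ} (S : Set X) (h : n ≤ k) : trunc k S n = Set.univ := by
  ext x; simp [trunc, not_lt.mpr h]

theorem trunc_of_lt {X : Type u} {k n : ℕ} (S : Set X) (h : k < n) : trunc k S n = S := by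
  ext x; simp [trunc, h]

theorem trunc_univ {X : Type u} (k n : ℕ) : trunc k (Set.univ : Set X) n = Set.univ := by
  ext x; simp [trunc]

variable {K E}

/-- The auxiliary game tree. -/
def auxTree (K : ℕ) (E : Set T.Node) (hK : K % 2 = 0) : PosTree.{u} where
  Node := {p // Valid K E p}
  len x := T.len x.1.1
  Ch x y := T.Ch x.1.1 y.1.1 ∧ x.1.2.1 = trunc K y.1.2.1 (T.len x.1.1) ∧
    x.1.2.2 = trunc (K + 1) y.1.2.2 (T.len x.1.1)
  ch_len h := T.ch_len h.1
  ch_uniq h h' := by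
    have := T.ch_uniq h.1 h'.1
    refine Subtype.ext (Prod.ext this (Prod.ext ?_ ?_))
    · rw [h.2.1, h'.2.1, this]
    · rw [h.2.2, h'.2.2, this]
  pruned := by
    rintro ⟨⟨x, S, O⟩, hx⟩
    have hS := hx.quasi
    rcases lt_trichotomy (T.len x) (K + 1) with h | h | h
    · obtain ⟨y, hy⟩ := T.pruned x
      have hl := T.ch_len hy
      obtain rfl : S = _ := hx.triv₁ (by dsimp only; omega)
      obtain rfl : O = _ := hx.triv₂ (by dsimp only; omega)
      rcases Nat.lt_succ_iff_lt_or_eq.mp h with h | h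
      · exact ⟨⟨_, .of_le (x := y) (by omega)⟩, hy, (trunc_univ _ _).symm, (trunc_univ _ _).symm⟩
      · exact ⟨⟨_, .of_eq (x := y) (by omega) hS trivial⟩, hy, (trunc_univ _ _).symm,
          (trunc_univ _ _).symm⟩
    · obtain ⟨y, hy⟩ := T.pruned x
      have hl := T.ch_len hy
      have hyS : y ∈ S := hS.all x (hx.mem₁ h) h.ge (by simp only [Mv]; simp; omega) y hy
      obtain rfl : O = _ := hx.triv₂ (by dsimp only; omega)
      suffices h' : ∃ O, Answer K E S O ∧ y ∈ O by
        obtain ⟨O, hO, hyO⟩ := h'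
        exact ⟨⟨_, .of_ge (x := y) (by omega) hS hO hyO⟩, hy,
          (trunc_of_lt _ (by dsimp only; omega)).symm, (trunc_of_le _ (by dsimp only; omega)).symm⟩
      by_cases hu : ∃ u ∈ S, u ∈ E ∧ T.Le y u
      · obtain ⟨u, huS, huE, hyu⟩ := hu
        exact ⟨cone u, .inl ⟨u, huS, huE, rfl⟩, .inl hyu⟩
      · refine ⟨{z | z ∈ S ∧ T.Le y z}, .inr ⟨fun z hz => hz.1, ?_, ?_, ?_⟩, hyS, .refl⟩
        · exact fun z hz hzE => hu ⟨z, hz.1, hzE, hz.2⟩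
        · intro z hz hl hm
          obtain ⟨w, hw⟩ := T.pruned z
          exact ⟨w, hw, hS.all z hz.1 (by omega) hm w hw, hz.2.tail hw⟩
        · exact fun z hz hl hm w hw hwS => ⟨hwS, hz.2.tail hw⟩
    · suffices h' : ∃ y, T.Ch x y ∧ y ∈ O by
        obtain ⟨y, hy, hyO⟩ := h'
        have hl := T.ch_len hy
        exact ⟨⟨_, .of_ge (x := y) (by omega) hS (hx.answer h) hyO⟩, hy,
          (trunc_of_lt _ (by dsimp only; omega)).symm, (trunc_of_lt _ h).symm⟩
      have hxO : x ∈ O := hx.mem₂ h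
      rcases hx.answer h with ⟨u, -, -, rfl⟩ | hO
      · exact exists_ch_mem_cone hxO
      · by_cases hm : Mv false (T.len x)
        · obtain ⟨y, hy, hyS⟩ := hS.one x (hO.sub hxO) (by omega) hm
          exact ⟨y, hy, hO.all x hxO h hm y hy hyS⟩
        · exact hO.one x hxO h (not_mv.mp hm)

/-- The projection of the auxiliary game. -/
def auxHom (K : ℕ) (E : Set T.Node) (hK : K % 2 = 0) : PosHom (auxTree K E hK) T where
  f x := x.1.1
  len _ := rfl
  ch h := h.1

variable (hK : K % 2 = 0)

/-- The auxiliary position over `b n` given the quasistrategies `S` and `O`. -/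
def liftAt (K : ℕ) (b : ℕ → T.Node) (S O : Set T.Node) (n : ℕ) :
    T.Node × Set T.Node × Set T.Node :=
  (b n, trunc K S n, trunc (K + 1) O n)

theorem valid_liftAt {b : ℕ → T.Node} (hb : T.IsBr b) {S O : Set T.Node} (hS : QuasiI K S)
    (hbS : b (K + 1) ∈ S) (hO : Answer K E S O) (hbO : ∀ n, K + 2 ≤ n → b n ∈ O) (n : ℕ) :
    Valid K E (liftAt K b S O n) := by
  have hl := hb.len n
  rcases lt_trichotomy n (K + 1) with h | rfl | h
  · rw [liftAt, trunc_of_le _ (by omega), trunc_of_le _ (by omega)]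
    exact .of_le (by omega)
  · rw [liftAt, trunc_of_lt _ (by omega), trunc_of_le _ (by omega)]
    exact .of_eq (by omega) hS hbS
  · rw [liftAt, trunc_of_lt _ (by omega), trunc_of_lt _ (by omega)]
    exact .of_ge (by omega) hS hO (hbO n h)

theorem exists_lift_play {b : ℕ → T.Node} (hb : T.IsBr b) {S O : Set T.Node} {i : Bool}
    {σ : {p // Valid K E p} → {p // Valid K E p}} (hσ : (auxTree K E hK).Leg σ)
    (hv : ∀ n, Valid K E (liftAt K b S O n))
    (hnext : ∀ n, Mv i n → (σ ⟨_, hv n⟩).1.1 = b (n + 1))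
    (hnext₁ : Mv i K → (σ ⟨_, hv K⟩).1.2.1 = S)
    (hnext₂ : Mv i (K + 1) → (σ ⟨_, hv (K + 1)⟩).1.2.2 = O) :
    ∃ b', (auxTree K E hK).Play i σ b' ∧ ∀ n, (b' n).1.1 = b n := by
  refine ⟨fun n => ⟨_, hv n⟩, ⟨⟨hb.1, fun n => ⟨hb.2 n, ?_, ?_⟩⟩, fun n hn => ?_⟩, fun n => rfl⟩
  · show trunc K S n = trunc K (trunc K S (n + 1)) (T.len (b n))
    rw [hb.len]
    rcases le_or_gt n K with h | h
    · rw [trunc_of_le _ h, trunc_of_le _ h]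
    · rw [trunc_of_lt _ h, trunc_of_lt _ h, trunc_of_lt _ (by omega)]
  · show trunc _ O n = trunc _ (trunc _ O (n + 1)) (T.len (b n))
    rw [hb.len]
    rcases le_or_gt n (K + 1) with h | h
    · rw [trunc_of_le _ h, trunc_of_le _ h]
    · rw [trunc_of_lt _ h, trunc_of_lt _ h, trunc_of_lt _ (by omega)]
  · obtain ⟨h0, h1, h2⟩ := hσ ⟨_, hv n⟩
    have hq := (σ ⟨_, hv n⟩).2
    have hl := T.ch_len h0
    change trunc K S n = trunc K _ (T.len (b n)) at h1
    change trunc _ O n = trunc _ _ (T.len (b n)) at h2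
    change T.len _ = T.len (b n) + 1 at hl
    rw [hb.len] at h1 h2 hl
    refine Subtype.ext (Prod.ext (hnext n hn).symm (Prod.ext ?_ ?_))
    · show trunc K S (n + 1) = _
      rcases lt_trichotomy n K with h | rfl | h
      · rw [trunc_of_le _ (by omega), hq.triv₁ (by omega)]
      · rw [trunc_of_lt _ (by omega), hnext₁ hn]
      · rw [trunc_of_lt _ (by omega)]
        rwa [trunc_of_lt _ h, trunc_of_lt _ h] at h1
    · show trunc _ O (n + 1) = _
      rcases lt_trichotomy n (K + 1) with h | rfl | h
      · rw [trunc_of_le _ (by omega), hq.triv₂ (by omega)]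
      · rw [trunc_of_lt _ (by omega), hnext₂ hn]
      · rw [trunc_of_lt _ (by omega)]
        rwa [trunc_of_lt _ h, trunc_of_lt _ h] at h2

open Classical in
/-- The move at the auxiliary position `p`, or at `p.1` alone if `p` is not legal. -/
noncomputable def pushAt (σ : {p // Valid K E p} → {p // Valid K E p}) (w : T.Node → T.Node)
    (p : T.Node × Set T.Node × Set T.Node) : T.Node :=
  if h : Valid K E p then (σ ⟨p, h⟩).1.1 else w p.1

theorem pushAt_of_valid (σ : {p // Valid K E p} → {p // Valid K E p}) (w : T.Node → T.Node)
    {p : T.Node × Set T.Node × Set T.Node} (h : Valid K E p) :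
    pushAt σ w p = (σ ⟨p, h⟩).1.1 := dif_pos h

theorem pushAt_of_not (σ : {p // Valid K E p} → {p // Valid K E p}) (w : T.Node → T.Node)
    {p : T.Node × Set T.Node × Set T.Node} (h : ¬ Valid K E p) :
    pushAt σ w p = w p.1 := dif_neg h

theorem ch_pushAt {σ : {p // Valid K E p} → {p // Valid K E p}} (hσ : (auxTree K E hK).Leg σ)
    {w : T.Node → T.Node} (hw : T.Leg w) (p : T.Node × Set T.Node × Set T.Node) :
    T.Ch p.1 (pushAt σ w p) := by
  by_cases h : Valid K E p
  · rw [pushAt_of_valid _ _ h]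
    exact (hσ ⟨p, h⟩).1
  · rw [pushAt_of_not _ _ h]
    exact hw _

theorem pushAt_congr {σ τ : {p // Valid K E p} → {p // Valid K E p}} {w : T.Node → T.Node}
    {p : T.Node × Set T.Node × Set T.Node} (h : ∀ h : Valid K E p, σ ⟨p, h⟩ = τ ⟨p, h⟩) :
    pushAt σ w p = pushAt τ w p := by
  by_cases hp : Valid K E p
  · rw [pushAt_of_valid _ _ hp, pushAt_of_valid _ _ hp, h]
  · rw [pushAt_of_not _ _ hp, pushAt_of_not _ _ hp]

theorem apply_congr (σ : {p // Valid K E p} → {p // Valid K E p})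
    {p q : T.Node × Set T.Node × Set T.Node} (h : p = q) (hp : Valid K E p) (hq : Valid K E q) :
    σ ⟨p, hp⟩ = σ ⟨q, hq⟩ := by
  subst h; rfl

theorem liftAt_of_le (b : ℕ → T.Node) (S O : Set T.Node) {n : ℕ} (h : n ≤ K) :
    liftAt K b S O n = (b n, Set.univ, Set.univ) := by
  rw [liftAt, trunc_of_le _ h, trunc_of_le _ (by omega)]

theorem liftAt_succ (b : ℕ → T.Node) (S O : Set T.Node) :
    liftAt K b S O (K + 1) = (b (K + 1), S, Set.univ) := by
  rw [liftAt, trunc_of_lt _ (by omega), trunc_of_le _ le_rfl]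

theorem liftAt_of_ge (b : ℕ → T.Node) (S O : Set T.Node) {n : ℕ} (h : K + 2 ≤ n) :
    liftAt K b S O n = (b n, S, O) := by
  rw [liftAt, trunc_of_lt _ (by omega), trunc_of_lt _ (by omega)]

/-- Past length `K + 1` the sets named in the auxiliary game are not changed by a move. -/
theorem third_apply {σ : {p // Valid K E p} → {p // Valid K E p}} (hσ : (auxTree K E hK).Leg σ)
    {p : T.Node × Set T.Node × Set T.Node} (hp : Valid K E p) (h : K + 2 ≤ T.len p.1) :
    (σ ⟨p, hp⟩).1.2.2 = p.2.2 := by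
  have h2 := (hσ ⟨p, hp⟩).2.2
  rw [trunc_of_lt _ (by exact h)] at h2
  exact h2.symm

theorem second_apply {σ : {p // Valid K E p} → {p // Valid K E p}} (hσ : (auxTree K E hK).Leg σ)
    {p : T.Node × Set T.Node × Set T.Node} (hp : Valid K E p) (h : K + 1 ≤ T.len p.1) :
    (σ ⟨p, hp⟩).1.2.1 = p.2.1 := by
  have h1 := (hσ ⟨p, hp⟩).2.1
  rw [trunc_of_lt _ (by exact h)] at h1
  exact h1.symm

theorem len_apply {σ : {p // Valid K E p} → {p // Valid K E p}} (hσ : (auxTree K E hK).Leg σ)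
    {p : T.Node × Set T.Node × Set T.Node} (hp : Valid K E p) :
    T.len (σ ⟨p, hp⟩).1.1 = T.len p.1 + 1 := T.ch_len (hσ ⟨p, hp⟩).1

theorem apply_mem_third {σ : {p // Valid K E p} → {p // Valid K E p}}
    (hσ : (auxTree K E hK).Leg σ)
    {p : T.Node × Set T.Node × Set T.Node} (hp : Valid K E p) (h : K + 1 ≤ T.len p.1) :
    (σ ⟨p, hp⟩).1.1 ∈ (σ ⟨p, hp⟩).1.2.2 :=
  (σ ⟨p, hp⟩).2.mem₂ (by rw [len_apply hK hσ]; omega)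

/-- The region from which the player moving at `j` can force a visit to `U`. -/
noncomputable def reachSet {X : Type u} (R : X → X → Prop) (j : X → Prop) (U : Set X) : Set X :=
  (exists_isReach R j U).choose

/-- The rank of a position of `reachSet`. -/
noncomputable def reachRank {X : Type u} (R : X → X → Prop) (j : X → Prop) (U : Set X) :
    X → Ordinal.{u} :=
  (exists_isReach R j U).choose_spec.choose

theorem isReach {X : Type u} (R : X → X → Prop) (j : X → Prop) (U : Set X) :
    IsReach R j U (reachSet R j U) (reachRank R j U) :=
  (exists_isReach R j U).choose_spec.choose_spec

/-- The moves that force a visit to `U`. -/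
noncomputable def reachMove (T : PosTree.{u}) (R : T.Node → T.Node → Prop) (j : T.Node → Prop)
    (U : Set T.Node) : T.Node → T.Node :=
  T.pick fun x y => R x y ∧ y ∈ reachSet R j U ∧ reachRank R j U y < reachRank R j U x

theorem reachMove_spec {R : T.Node → T.Node → Prop} (hR : ∀ x y, R x y → T.Ch x y)
    {j : T.Node → Prop} {U : Set T.Node} {x : T.Node} (hx : x ∈ reachSet R j U) (hU : x ∉ U)
    (hj : j x) : R x (reachMove T R j U x) ∧ reachMove T R j U x ∈ reachSet R j U ∧
      reachRank R j U (reachMove T R j U x) < reachRank R j U x := by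
  obtain ⟨y, hy, h⟩ := (isReach R j U).mine_in x hx hU hj
  exact pick_spec (Q := fun x y => R x y ∧ y ∈ reachSet R j U ∧
    reachRank R j U y < reachRank R j U x) (hR x y hy) ⟨hy, h⟩

/-- The quasistrategy played by `σ` at length `K` on the way to `x`. -/
def secondAt (σ : {p // Valid K E p} → {p // Valid K E p}) (x : T.Node) : Set T.Node :=
  {y | ∃ q, T.Le q x ∧ T.len q = K ∧ ∃ h : Valid K E (q, Set.univ, Set.univ),
    y ∈ (σ ⟨_, h⟩).1.2.1}

/-- The answer of `σ` to `S` at length `K + 1` on the way to `x`. -/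
def thirdAt (σ : {p // Valid K E p} → {p // Valid K E p}) (S : Set T.Node) (x : T.Node) :
    Set T.Node :=
  {y | ∃ q, T.Le q x ∧ T.len q = K + 1 ∧ ∃ h : Valid K E (q, S, Set.univ),
    y ∈ (σ ⟨_, h⟩).1.2.2}

theorem secondAt_eq (σ : {p // Valid K E p} → {p // Valid K E p}) {q x : T.Node} (hq : T.Le q x)
    (hl : T.len q = K) : secondAt σ x = (σ ⟨_, Valid.of_le hl.le⟩).1.2.1 := by
  ext y
  constructor
  · rintro ⟨q', hq', hl', h, hy⟩
    obtain rfl := hq'.unique hq (hl'.trans hl.symm)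
    exact hy
  · exact fun hy => ⟨q, hq, hl, _, hy⟩

theorem thirdAt_eq (σ : {p // Valid K E p} → {p // Valid K E p}) {q x : T.Node} (hq : T.Le q x)
    (hl : T.len q = K + 1) {S : Set T.Node} (h : Valid K E (q, S, Set.univ)) :
    thirdAt σ S x = (σ ⟨_, h⟩).1.2.2 := by
  ext y
  constructor
  · rintro ⟨q', hq', hl', h, hy⟩
    obtain rfl := hq'.unique hq (hl'.trans hl.symm)
    exact hy
  · exact fun hy => ⟨q, hq, hl, _, hy⟩

theorem secondAt_congr {σ τ : {p // Valid K E p} → {p // Valid K E p}} {x : T.Node}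
    (h : ∀ p : {p // Valid K E p}, T.len p.1.1 ≤ T.len x → σ p = τ p) :
    secondAt σ x = secondAt τ x := by
  ext y
  refine exists_congr fun q => and_congr_right fun hq => and_congr_right fun _ =>
    exists_congr fun hv => ?_
  rw [h ⟨_, hv⟩ hq.len]

theorem thirdAt_congr {σ τ : {p // Valid K E p} → {p // Valid K E p}} (S : Set T.Node)
    (x : T.Node) (h : ∀ p : {p // Valid K E p}, T.len p.1.1 ≤ K + 1 → σ p = τ p) :
    thirdAt σ S x = thirdAt τ S x := by
  ext y
  refine exists_congr fun q => and_congr_right fun _ => and_congr_right fun hq =>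
    exists_congr fun hv => ?_
  rw [h ⟨_, hv⟩ hq.le]

/-- Moves within `S`. -/
def ChIn (S : Set T.Node) (x y : T.Node) : Prop := T.Ch x y ∧ y ∈ S

/-- The region where the first player forces a visit to `E` within `S`. -/
noncomputable def winI (E S : Set T.Node) : Set T.Node :=
  reachSet (ChIn S) (fun x => Mv false (T.len x)) (S ∩ E)

/-- The answer to `S` imagined by the first player at `x`. -/
noncomputable def answerI (K : ℕ) (E S : Set T.Node) (x : T.Node) : Set T.Node :=
  byFirst (S ∩ E) cone (S ∩ avoid (winI E S) (K + 2)) x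

/-- The image of a strategy of the first player in the auxiliary game. -/
noncomputable def stratI (σ : {p // Valid K E p} → {p // Valid K E p}) (x : T.Node) : T.Node :=
  pushAt σ (reachMove T (ChIn (secondAt σ x)) (fun x => Mv false (T.len x)) (secondAt σ x ∩ E))
    (x, trunc K (secondAt σ x) (T.len x),
      trunc (K + 1) (answerI K E (secondAt σ x) x) (T.len x))

theorem stratI_lift (hE : ∀ x ∈ E, K + 2 ≤ T.len x)
    {σ : {p // Valid K E p} → {p // Valid K E p}} (hσ : (auxTree K E hK).Leg σ)
    {b : ℕ → T.Node} (hb : T.Play false (stratI σ) b) :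
    ∃ b', (auxTree K E hK).Play false σ b' ∧ ∀ n, (b' n).1.1 = b n := by
  obtain ⟨hb, hplay⟩ := hb
  set q := σ ⟨_, Valid.of_le (hb.len K).le⟩ with hq
  set S := q.1.2.1 with hSdef
  have hsec : ∀ m, K ≤ m → secondAt σ (b m) = S := fun m hm =>
    secondAt_eq σ (hb.le hm) (hb.len K)
  have hS : QuasiI K S := q.2.quasi
  have hlow : ∀ m, m ≤ K → Mv false m → ∀ h : Valid K E (b m, Set.univ, Set.univ),
      b (m + 1) = (σ ⟨_, h⟩).1.1 := by
    intro m hm hmv h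
    rw [hplay m hmv, stratI, hb.len, trunc_of_le _ hm, trunc_of_le _ (by omega),
      pushAt_of_valid _ _ h]
  have hmK : Mv false K := hK
  have hbS : b (K + 1) ∈ S := by
    have h := q.2.mem₁
    rw [← hlow K le_rfl hmK, hb.len] at h
    exact h rfl
  have hhigh : ∀ m, K + 2 ≤ m → Mv false m → b (m + 1) =
      pushAt σ (reachMove T (ChIn S) (fun x => Mv false (T.len x)) (S ∩ E))
        (b m, S, answerI K E S (b m)) := by
    intro m hm hmv
    rw [hplay m hmv, stratI, hb.len, hsec m (by omega), trunc_of_lt _ (by omega),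
      trunc_of_lt _ (by omega)]
  -- it remains to find the answer of the second player
  suffices h : ∃ O, Answer K E S O ∧ (∀ n, K + 2 ≤ n → b n ∈ O) ∧
      ∀ n, K + 2 ≤ n → Mv false n → ∀ h : Valid K E (b n, S, O), (σ ⟨_, h⟩).1.1 = b (n + 1) by
    obtain ⟨O, hO, hbO, hnext⟩ := h
    refine exists_lift_play hK hb hσ (valid_liftAt hb hS hbS hO hbO) (fun n hn => ?_) ?_ ?_
    · rcases lt_trichotomy n (K + 1) with h | rfl | h
      · rw [hlow n (by omega) hn (.of_le (by rw [hb.len]; omega)),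
          apply_congr σ (liftAt_of_le b S O (by omega))]
      · simp [Mv] at hn; omega
      · have hv' : Valid K E (b n, S, O) :=
          liftAt_of_ge b S O h ▸ valid_liftAt hb hS hbS hO hbO n
        rw [← hnext n h hn hv', apply_congr σ (liftAt_of_ge b S O h)]
    · intro _
      rw [apply_congr σ (liftAt_of_le b S O le_rfl)]
    · intro h
      simp [Mv] at h; omega
  by_cases hA : ∃ n, b n ∈ S ∩ E
  · classical
    obtain ⟨n, hn, hmin⟩ : ∃ n, b n ∈ S ∩ E ∧ ∀ k < n, b k ∉ S ∩ E :=
      ⟨Nat.find hA, Nat.find_spec hA, fun k hk => Nat.find_min hA hk⟩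
    refine ⟨cone (b n), .inl ⟨_, hn.1, hn.2, rfl⟩, fun m _ => hb.mem_cone m n, fun m hm hmv h => ?_⟩
    rcases lt_or_ge m n with hmn | hmn
    · have hc := len_apply hK hσ h
      have hmem := apply_mem_third hK hσ h (by rw [hb.len]; omega)
      rw [third_apply hK hσ h (by rwa [hb.len])] at hmem
      dsimp only at hc
      rw [hb.len] at hc
      rw [hb.eq_of_mem_cone hmem (by omega), hc]
    · rw [hhigh m hm hmv]
      simp only [answerI, hb.byFirst_eq hn hmin hmn]
      rw [pushAt_of_valid _ _ h]
  · push Not at hA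
    have hreach := isReach (ChIn S) (fun x => Mv false (T.len x)) (S ∩ E)
    have hans : ∀ m, answerI K E S (b m) = S ∩ avoid (winI E S) (K + 2) :=
      fun m => hb.byFirst_eq_of_notMem hA m _ _
    have hII : QuasiII K E S (S ∩ avoid (winI E S) (K + 2)) := quasiII_avoid hE hreach
    have hpush : ∀ m, K + 2 ≤ m → Mv false m →
        ∀ h : Valid K E (b m, S, S ∩ avoid (winI E S) (K + 2)), (σ ⟨_, h⟩).1.1 = b (m + 1) := by
      intro m hm hmv h
      rw [hhigh m hm hmv, hans, pushAt_of_valid _ _ h]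
    have hstep : ∀ m, K + 2 ≤ m → b m ∈ S ∩ winI E S → b (m + 1) ∈ S ∩ winI E S ∧
        reachRank (ChIn S) (fun x => Mv false (T.len x)) (S ∩ E) (b (m + 1)) <
        reachRank (ChIn S) (fun x => Mv false (T.len x)) (S ∩ E) (b m) := by
      rintro m hm ⟨hmS, hmW⟩
      by_cases hmv : Mv false m
      · have hnv : ¬ Valid K E (b m, S, S ∩ avoid (winI E S) (K + 2)) := fun h =>
          notMem_of_mem_avoid (h.mem₂ (by rw [hb.len]; exact hm)).2 (by rw [hb.len]; exact hm) hmW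
        have h := reachMove_spec (R := ChIn S) (fun _ _ h => h.1) hmW (hA m) (by rwa [hb.len])
        have h' := hhigh m hm hmv
        rw [hans, pushAt_of_not _ _ hnv] at h'
        dsimp only at h'
        rw [← h'] at h
        exact ⟨⟨h.1.2, h.2.1⟩, h.2.2⟩
      · have hyS := hS.all _ hmS (by rw [hb.len]; omega) (by rw [hb.len]; exact not_mv.mp hmv) _
          (hb.2 m)
        have h := hreach.other_in _ hmW (hA m) (by rwa [hb.len]) _ ⟨hb.2 m, hyS⟩
        exact ⟨⟨hyS, h.1⟩, h.2⟩
    have hout := notMem_of_descent hstep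
    have hin : ∀ m, K + 1 ≤ m → ∀ k, K + 1 ≤ k → k ≤ m → b k ∈ S := by
      intro m hm
      induction m, hm using Nat.le_induction with
      | base => intro k h1 h2; rwa [le_antisymm h2 h1]
      | succ m hm ih =>
        intro k hk1 hk2
        rcases hk2.lt_or_eq with hk2 | rfl
        · exact ih k hk1 (by omega)
        by_cases hmv : Mv false m
        · have hm2 : K + 2 ≤ m := by
            rcases hm.lt_or_eq with h | h
            · exact h
            · simp [Mv] at hmv; omega
          have hmem : b m ∈ S ∩ avoid (winI E S) (K + 2) :=
            ⟨ih m hm le_rfl, hb.mem_avoid fun j h1 h2 hW => hout j h1 ⟨ih j (by omega) h2, hW⟩⟩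
          have hv : Valid K E (b m, S, S ∩ avoid (winI E S) (K + 2)) :=
            .of_ge (by rwa [hb.len]) hS (.inr hII) hmem
          have h4 := apply_mem_third hK hσ hv (by rw [hb.len]; omega)
          rw [third_apply hK hσ hv (by rwa [hb.len]), hpush m hm2 hmv hv] at h4
          exact h4.1
        · exact hS.all _ (ih m hm le_rfl) (by rw [hb.len]; omega)
            (by rw [hb.len]; exact not_mv.mp hmv) _ (hb.2 m)
    exact ⟨_, .inr hII, fun m hm => ⟨hin m (by omega) m (by omega) le_rfl, hb.mem_avoid
      fun j h1 h2 hW => hout j h1 ⟨hin m (by omega) j (by omega) h2, hW⟩⟩, hpush⟩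

/-- The quasistrategies to which `σ` answers by naming `u`. -/
def witness (σ : {p // Valid K E p} → {p // Valid K E p}) (u : T.Node) : Set (Set T.Node) :=
  {S | (∃ q, T.Le q u ∧ T.len q = K + 1 ∧ Valid K E (q, S, Set.univ)) ∧ thirdAt σ S u = cone u ∧
    u ∈ S ∧ u ∈ E}

/-- The positions that `σ` can be induced to name. -/
def named (σ : {p // Valid K E p} → {p // Valid K E p}) : Set T.Node := {u | (witness σ u).Nonempty}

/-- A quasistrategy to which `σ` answers by naming `u`. -/
noncomputable def witnessAt (σ : {p // Valid K E p} → {p // Valid K E p}) (u : T.Node) :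
    Set T.Node :=
  Classical.epsilon (· ∈ witness σ u)

theorem witnessAt_mem {σ : {p // Valid K E p} → {p // Valid K E p}} {u : T.Node}
    (h : u ∈ named σ) : witnessAt σ u ∈ witness σ u :=
  Classical.epsilon_spec h

theorem witness_congr {σ τ : {p // Valid K E p} → {p // Valid K E p}}
    (h : ∀ p : {p // Valid K E p}, T.len p.1.1 ≤ K + 1 → σ p = τ p) : witness σ = witness τ := by
  ext u S
  simp only [witness, Set.mem_ofPred_eq, thirdAt_congr S u h]

/-- The region where the second player forces a visit to a named position. -/
noncomputable def winII (σ : {p // Valid K E p} → {p // Valid K E p}) : Set T.Node :=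
  reachSet T.Ch (fun x => Mv true (T.len x)) (named σ)

/-- The quasistrategy of the first player that avoids all named positions. -/
noncomputable def dodge (σ : {p // Valid K E p} → {p // Valid K E p}) : Set T.Node :=
  avoid (winII σ) (K + 1)

/-- The image of a strategy of the second player in the auxiliary game. -/
noncomputable def stratII (σ : {p // Valid K E p} → {p // Valid K E p}) (x : T.Node) : T.Node :=
  pushAt σ (reachMove T T.Ch (fun x => Mv true (T.len x)) (named σ))
    (x, trunc K (byFirst (named σ) (witnessAt σ) (dodge σ) x) (T.len x),
      trunc (K + 1) (byFirst (named σ) cone (thirdAt σ (dodge σ) x) x) (T.len x))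

theorem stratII_congr {σ τ : {p // Valid K E p} → {p // Valid K E p}} {x : T.Node}
    (h : ∀ p : {p // Valid K E p}, T.len p.1.1 ≤ T.len x → σ p = τ p) :
    stratII σ x = stratII τ x := by
  rcases le_or_gt (T.len x) K with hx | hx
  · rw [stratII, stratII, trunc_of_le _ hx, trunc_of_le _ hx, trunc_of_le _ (by omega),
      trunc_of_le _ (by omega), pushAt_of_valid _ _ (.of_le hx), pushAt_of_valid _ _ (.of_le hx),
      h ⟨_, .of_le hx⟩ le_rfl]
  · have h' : ∀ p : {p // Valid K E p}, T.len p.1.1 ≤ K + 1 → σ p = τ p :=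
      fun p hp => h p (hp.trans hx)
    have hn : named σ = named τ := by simp only [named, witness_congr h']
    have hw : witnessAt σ = witnessAt τ := by
      funext u
      simp only [witnessAt, witness_congr h']
    have hd : dodge σ = dodge τ := by simp only [dodge, winII, hn]
    rw [stratII, stratII, hn, hw, hd, thirdAt_congr _ _ h']
    exact pushAt_congr fun hv => h _ le_rfl

theorem stratI_congr {σ τ : {p // Valid K E p} → {p // Valid K E p}} {x : T.Node}
    (h : ∀ p : {p // Valid K E p}, T.len p.1.1 ≤ T.len x → σ p = τ p) :
    stratI σ x = stratI τ x := by
  rw [stratI, stratI, secondAt_congr h]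
  exact pushAt_congr fun hv => h _ le_rfl

theorem leg_stratI {σ : {p // Valid K E p} → {p // Valid K E p}} (hσ : (auxTree K E hK).Leg σ) :
    T.Leg (stratI σ) := fun x => ch_pushAt hK hσ (leg_pick _) (x, _)

theorem leg_stratII {σ : {p // Valid K E p} → {p // Valid K E p}} (hσ : (auxTree K E hK).Leg σ) :
    T.Leg (stratII σ) := fun x => ch_pushAt hK hσ (leg_pick _) (x, _)

theorem stratI_of_le (σ : {p // Valid K E p} → {p // Valid K E p}) {x : T.Node}
    (h : T.len x ≤ K) : stratI σ x = (σ ⟨_, .of_le h⟩).1.1 := by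
  rw [stratI, trunc_of_le _ h, trunc_of_le _ (by omega), pushAt_of_valid _ _ (.of_le h)]

theorem stratII_of_le (σ : {p // Valid K E p} → {p // Valid K E p}) {x : T.Node}
    (h : T.len x ≤ K) : stratII σ x = (σ ⟨_, .of_le h⟩).1.1 := by
  rw [stratII, trunc_of_le _ h, trunc_of_le _ (by omega), pushAt_of_valid _ _ (.of_le h)]

theorem quasiII_answer_dodge (hE : ∀ x ∈ E, K + 2 ≤ T.len x)
    {σ : {p // Valid K E p} → {p // Valid K E p}} (hσ : (auxTree K E hK).Leg σ) {q : T.Node}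
    (hq : T.len q = K + 1) (hv : Valid K E (q, dodge σ, Set.univ)) :
    QuasiII K E (dodge σ) (σ ⟨_, hv⟩).1.2.2 := by
  have hl := len_apply hK hσ hv
  have hans := (σ ⟨_, hv⟩).2.answer (by rw [hl]; dsimp only; omega)
  rw [second_apply hK hσ hv hq.ge] at hans
  rcases hans with ⟨u, huS, huE, hO⟩ | h
  · have hy := apply_mem_third hK hσ hv hq.ge
    rw [hO] at hy
    have hqu : T.Le q u :=
      .head (hσ ⟨_, hv⟩).1 (le_of_mem_cone hy (by have := hE u huE; dsimp only at hl; omega))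
    have hu : u ∈ named σ := ⟨_, ⟨q, hqu, hq, hv⟩, by rw [thirdAt_eq σ hqu hq hv, hO], huS, huE⟩
    exact absurd ((isReach _ _ _).sub hu)
      (notMem_of_mem_avoid huS (by have := hE u huE; omega))
  · exact h

theorem stratII_lift (hE : ∀ x ∈ E, K + 2 ≤ T.len x)
    {σ : {p // Valid K E p} → {p // Valid K E p}} (hσ : (auxTree K E hK).Leg σ)
    {b : ℕ → T.Node} (hb : T.Play true (stratII σ) b) :
    ∃ b', (auxTree K E hK).Play true σ b' ∧ ∀ n, (b' n).1.1 = b n := by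
  obtain ⟨hb, hplay⟩ := hb
  have hmK : Mv true (K + 1) := by simp only [Mv, if_true]; omega
  suffices h : ∃ S O, QuasiI K S ∧ Answer K E S O ∧ b (K + 1) ∈ S ∧ (∀ n, K + 2 ≤ n → b n ∈ O) ∧
      (∀ h : Valid K E (b (K + 1), S, Set.univ),
        (σ ⟨_, h⟩).1.1 = b (K + 2) ∧ (σ ⟨_, h⟩).1.2.2 = O) ∧
      ∀ n, K + 2 ≤ n → Mv true n → ∀ h : Valid K E (b n, S, O), (σ ⟨_, h⟩).1.1 = b (n + 1) by
    obtain ⟨S, O, hS, hO, hbS, hbO, hmid, hnext⟩ := h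
    have hv := valid_liftAt hb hS hbS hO hbO
    have hv' : Valid K E (b (K + 1), S, Set.univ) := liftAt_succ b S O ▸ hv (K + 1)
    refine exists_lift_play hK hb hσ hv (fun n hn => ?_) ?_ ?_
    · rcases lt_trichotomy n (K + 1) with h | rfl | h
      · have hl : T.len (b n) ≤ K := by rw [hb.len]; omega
        rw [hplay n hn, stratII_of_le σ hl, apply_congr σ (liftAt_of_le b S O (by omega))]
      · rw [apply_congr σ (liftAt_succ b S O) _ hv', (hmid hv').1]
      · have hv'' : Valid K E (b n, S, O) := liftAt_of_ge b S O h ▸ hv n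
        rw [apply_congr σ (liftAt_of_ge b S O h) _ hv'', hnext n h hn hv'']
    · intro h
      simp [Mv] at h; omega
    · intro _
      rw [apply_congr σ (liftAt_succ b S O) _ hv', (hmid hv').2]
  by_cases hA : ∃ n, b n ∈ named σ
  · classical
    obtain ⟨n, hn, hmin⟩ : ∃ n, b n ∈ named σ ∧ ∀ k < n, b k ∉ named σ :=
      ⟨Nat.find hA, Nat.find_spec hA, fun k hk => Nat.find_min hA hk⟩
    obtain ⟨⟨q, hqn, hq, hqv⟩, hthird, hnS, hnE⟩ := witnessAt_mem hn
    have hKn : K + 2 ≤ n := by simpa [hb.len] using hE _ hnE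
    have hqb := hb.eq_of_le hqn
    rw [hq] at hqb
    rw [hqb] at hqv
    have hO : (σ ⟨_, hqv⟩).1.2.2 = cone (b n) := by
      rw [← thirdAt_eq σ (hb.le (show K + 1 ≤ n by omega)) (hb.len _) hqv, hthird]
    -- before the named position is reached, all moves are forced
    have hforced : ∀ m, K + 1 ≤ m → m < n → ∀ p, ∀ h : Valid K E p, T.len p.1 = m →
        (σ ⟨_, h⟩).1.2.2 = cone (b n) → (σ ⟨_, h⟩).1.1 = b (m + 1) := by
      intro m hm hmn p h hp hc
      have hmem := apply_mem_third hK hσ h (by omega)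
      have hl := len_apply hK hσ h
      rw [hc] at hmem
      rw [hb.eq_of_mem_cone hmem (by omega), hl, hp]
    refine ⟨witnessAt σ (b n), cone (b n), hqv.quasi, .inl ⟨_, hnS, hnE, rfl⟩,
      hqv.mem₁ (hb.len _), fun m _ => hb.mem_cone m n, fun h => ⟨?_, hO⟩, fun m hm hmv h => ?_⟩
    · exact hforced _ le_rfl (by omega) _ h (hb.len _) hO
    · rcases lt_or_ge m n with hmn | hmn
      · exact hforced m (by omega) hmn _ h (hb.len _) (third_apply hK hσ h (by rwa [hb.len]))
      · rw [hplay m hmv, stratII, hb.byFirst_eq hn hmin hmn, hb.byFirst_eq hn hmin hmn, hb.len,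
          trunc_of_lt _ (by omega), trunc_of_lt _ (by omega), pushAt_of_valid _ _ h]
  · push Not at hA
    have hreach := isReach T.Ch (fun x => Mv true (T.len x)) (named σ)
    have hpush : ∀ m, Mv true m → b (m + 1) =
        pushAt σ (reachMove T T.Ch (fun x => Mv true (T.len x)) (named σ))
          (b m, trunc K (dodge σ) m, trunc (K + 1) (thirdAt σ (dodge σ) (b m)) m) := by
      intro m hmv
      rw [hplay m hmv, stratII, hb.byFirst_eq_of_notMem hA, hb.byFirst_eq_of_notMem hA, hb.len]
    have hstep : ∀ m, K + 1 ≤ m → b m ∈ winII σ → b (m + 1) ∈ winII σ ∧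
        reachRank T.Ch (fun x => Mv true (T.len x)) (named σ) (b (m + 1)) <
        reachRank T.Ch (fun x => Mv true (T.len x)) (named σ) (b m) := by
      intro m hm hmW
      by_cases hmv : Mv true m
      · have hnS : b m ∉ dodge σ := fun h =>
          notMem_of_mem_avoid h (by rwa [hb.len]) hmW
        have hnv : ¬ Valid K E
            (b m, trunc K (dodge σ) m, trunc (K + 1) (thirdAt σ (dodge σ) (b m)) m) := by
          intro h
          rw [trunc_of_lt _ (by omega)] at h
          rcases hm.eq_or_lt with rfl | hm
          · exact hnS (h.mem₁ (hb.len _))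
          · rw [trunc_of_lt _ hm] at h
            obtain ⟨q, hqm, hq, hv, hmem⟩ := h.mem₂ (by rwa [hb.len])
            exact hnS ((quasiII_answer_dodge hK hE hσ hq hv).sub hmem)
        have h := reachMove_spec (fun _ _ h => h) hmW (hA m) (by rwa [hb.len])
        have h' := hpush m hmv
        rw [pushAt_of_not _ _ hnv] at h'
        dsimp only at h'
        rw [← h'] at h
        exact h.2
      · exact hreach.other_in _ hmW (hA m) (by rwa [hb.len]) _ (hb.2 m)
    have hout := notMem_of_descent hstep
    have hin : ∀ m, b m ∈ dodge σ := fun m => hb.mem_avoid fun j h1 _ => hout j h1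
    have hS : QuasiI K (dodge σ) := quasiI_avoid K hreach
    have hv : Valid K E (b (K + 1), dodge σ, Set.univ) := .of_eq (hb.len _) hS (hin _)
    have hII := quasiII_answer_dodge hK hE hσ (hb.len _) hv
    have hmove : b (K + 2) = (σ ⟨_, hv⟩).1.1 := by
      have h := hpush (K + 1) hmK
      rwa [trunc_of_lt _ (by omega), trunc_of_le _ le_rfl, pushAt_of_valid _ _ hv] at h
    have hnext : ∀ m, K + 2 ≤ m → Mv true m →
        ∀ h : Valid K E (b m, dodge σ, (σ ⟨_, hv⟩).1.2.2), (σ ⟨_, h⟩).1.1 = b (m + 1) := by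
      intro m hm hmv h
      rw [hpush m hmv, trunc_of_lt _ (by omega), trunc_of_lt _ (by omega),
        thirdAt_eq σ (hb.le (by omega)) (hb.len _) hv, pushAt_of_valid _ _ h]
    refine ⟨_, _, hS, .inr hII, hin _, fun m hm => ?_, fun h => ⟨hmove.symm, rfl⟩, hnext⟩
    induction m, hm using Nat.le_induction with
    | base => exact hmove ▸ apply_mem_third hK hσ hv (by rw [hb.len])
    | succ m hm ih =>
      by_cases hmv : Mv true m
      · have h := Valid.of_ge (by rwa [hb.len]) hS (.inr hII) ih
        have hmem := apply_mem_third hK hσ h (by rw [hb.len]; omega)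
        rwa [third_apply hK hσ h (by rwa [hb.len]), hnext m hm hmv h] at hmem
      · exact hII.all _ ih (by rwa [hb.len]) (by rw [hb.len]; exact not_mv.mp hmv) _ (hb.2 m)
          (hin _)

/-- The covering that unravels the complement of the open set given by `E`. -/
noncomputable def auxCov (hE : ∀ x ∈ E, K + 2 ≤ T.len x) : PosCov (auxTree K E hK) T where
  toPosHom := auxHom K E hK
  φ i := if i then stratII else stratI
  leg i σ hσ := by
    cases i
    exacts [leg_stratI hK hσ, leg_stratII hK hσ]
  loc i σ τ _ _ x h := by
    cases i
    exacts [stratI_congr h, stratII_congr h]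
  lift i σ hσ b hb := by
    cases i
    exacts [stratI_lift hK hE hσ hb, stratII_lift hK hE hσ hb]

theorem auxTree_eq_of_le {x : (auxTree K E hK).Node} (h : T.len x.1.1 ≤ K) :
    x = ⟨(x.1.1, Set.univ, Set.univ), .of_le h⟩ :=
  Subtype.ext (Prod.ext rfl (Prod.ext (x.2.triv₁ h) (x.2.triv₂ (by omega))))

theorem auxCov_fix (hE : ∀ x ∈ E, K + 2 ≤ T.len x) {k : ℕ} (hk : k ≤ K) :
    (auxCov hK hE).Fix k where
  inj x y hx hy h := by
    change x.1.1 = y.1.1 at h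
    rw [auxTree_eq_of_le hK (hx.trans hk), auxTree_eq_of_le hK (hy.trans hk)]
    exact Subtype.ext (Prod.ext h rfl)
  surj y hy := ⟨⟨_, .of_le (hy.trans hk)⟩, rfl⟩
  refl x y hy h := by
    have hl := T.ch_len h
    change T.len y.1.1 = T.len x.1.1 + 1 at hl
    change T.len y.1.1 ≤ k at hy
    refine ⟨h, ?_, ?_⟩
    · rw [x.2.triv₁ (by omega), trunc_of_le _ (by omega)]
    · rw [x.2.triv₂ (by omega), trunc_of_le _ (by omega)]
  ind i σ hσ x hx := by
    have hl : T.len x.1.1 ≤ K := hx.le.trans hk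
    conv_rhs => rw [auxTree_eq_of_le hK hl]
    cases i
    exacts [stratI_of_le σ hl, stratII_of_le σ hl]

theorem auxTree_br_const {b : ℕ → (auxTree K E hK).Node} (hb : (auxTree K E hK).IsBr b)
    {n m : ℕ} (hn : K + 2 ≤ n) (hm : n ≤ m) : (b m).1.2 = (b n).1.2 := by
  induction m, hm using Nat.le_induction with
  | base => rfl
  | succ m hm ih =>
    have hl : T.len (b m).1.1 = m := hb.len m
    obtain ⟨-, h1, h2⟩ := hb.2 m
    rw [hl, trunc_of_lt _ (by omega)] at h1 h2
    rw [← ih]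
    exact Prod.ext h1.symm h2.symm

/-- The auxiliary positions at which the second player has named a position in `E`. -/
def naming (K : ℕ) (E : Set T.Node) (hK : K % 2 = 0) : Set (auxTree K E hK).Node :=
  {p | ∃ u ∈ p.1.2.1, u ∈ E ∧ p.1.2.2 = cone u}

theorem exists_mem_iff_naming {b : ℕ → (auxTree K E hK).Node} (hb : (auxTree K E hK).IsBr b)
    (hE : ∀ x ∈ E, K + 2 ≤ T.len x) {n : ℕ} (hn : K + 2 ≤ n) :
    (∃ m, (b m).1.1 ∈ E) ↔ b n ∈ naming K E hK := by
  have hb' := (auxHom K E hK).isBr hb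
  have hlen : ∀ m, T.len (b m).1.1 = m := hb'.len
  have hconst : ∀ m, K + 2 ≤ m → (b m).1.2 = (b (K + 2)).1.2 := fun m hm =>
    auxTree_br_const hK hb le_rfl hm
  constructor
  · rintro ⟨m, hm⟩
    have hKm : K + 2 ≤ m := by simpa [hlen] using hE _ hm
    rw [naming, Set.mem_ofPred_eq, hconst n hn, ← hconst m hKm]
    rcases (b m).2.answer (by rwa [hlen]) with h | h
    · exact h
    · exact absurd hm (h.disj _ ((b m).2.mem₂ (by rwa [hlen])))
  · rintro ⟨u, -, huE, hu⟩
    have hKu := hE u huE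
    have hmem := (b (T.len u)).2.mem₂ (by rwa [hlen])
    rw [hconst _ hKu, ← hconst n hn, hu] at hmem
    refine ⟨T.len u, ?_⟩
    rwa [(le_of_mem_cone hmem (hlen _).le).eq_of_len (hlen _).ge]

end Closed

/-- Closed games can be unravelled. -/
theorem closed_unravels {T : PosTree.{u}} {P : Set (ℕ → T.Node)} (hP : T.Op Pᶜ) :
    Unravels T P := by
  obtain ⟨D, hD⟩ := hP
  intro k
  have hK : (2 * k) % 2 = 0 := by omega
  set E : Set T.Node := {y | 2 * k + 2 ≤ T.len y ∧ ∃ v, T.Le v y ∧ v ∈ D} with hEdef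
  have hE : ∀ x ∈ E, 2 * k + 2 ≤ T.len x := fun x hx => hx.1
  have key : ∀ b, (auxTree (2 * k) E hK).IsBr b →
      ∀ n, 2 * k + 2 ≤ n → (b ∈ ((auxHom _ E hK).pre P)ᶜ ↔ b n ∈ naming _ E hK) := by
    intro b hb n hn
    have hb' := (auxHom _ E hK).isBr hb
    rw [← exists_mem_iff_naming hK hb hE hn]
    refine (hD _ hb').trans
      ⟨fun ⟨m, hm⟩ => ⟨max m (2 * k + 2), ?_, _, hb'.le (le_max_left _ _), hm⟩,
      fun ⟨m, _, v, hv, hvD⟩ => ⟨_, (hb'.eq_of_le hv) ▸ hvD⟩⟩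
    exact (le_max_right _ _).trans (hb'.len _).ge
  refine ⟨_, auxCov hK hE, auxCov_fix hK hE (by omega),
    ⟨{p | 2 * k + 2 ≤ T.len p.1.1 ∧ p ∉ naming _ E hK}, fun b hb => ?_⟩,
    ⟨{p | 2 * k + 2 ≤ T.len p.1.1 ∧ p ∈ naming _ E hK}, fun b hb => ?_⟩⟩
  all_goals have hlen : ∀ m, T.len (b m).1.1 = m := ((auxHom _ E hK).isBr hb).len
  · simp only [Set.mem_ofPred_eq, hlen]
    constructor
    · exact fun h => ⟨_, le_rfl, fun hn => (key b hb _ le_rfl).mpr hn h⟩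
    · exact fun ⟨n, hn, h⟩ => not_not.mp fun h' => h ((key b hb n hn).mp h')
  · simp only [Set.mem_ofPred_eq, hlen]
    constructor
    · exact fun h => ⟨_, le_rfl, (key b hb _ le_rfl).mp h⟩
    · exact fun ⟨n, hn, h⟩ => (key b hb n hn).mpr h

theorem Unravels.compl {T : PosTree.{u}} {P : Set (ℕ → T.Node)} (h : Unravels T P) :
    Unravels T Pᶜ := fun k =>
  let ⟨S, c, hc, h1, h2⟩ := h k
  ⟨S, c, hc, h2, (compl_compl (c.pre P)).symm ▸ h1⟩

/-- All preimages of the payoff set can be unravelled. -/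
def UnivUnravels (T : PosTree.{u}) (P : Set (ℕ → T.Node)) : Prop :=
  ∀ (S : PosTree.{u}) (h : PosHom S T), Unravels S (h.pre P)

theorem PosTree.Op.univUnravels {T : PosTree.{u}} {P : Set (ℕ → T.Node)} (hP : T.Op P) :
    UnivUnravels T P := fun S h => by
  rw [← compl_compl (h.pre P)]
  exact (closed_unravels (by rw [compl_compl]; exact h.op_pre hP)).compl

theorem UnivUnravels.compl {T : PosTree.{u}} {P : Set (ℕ → T.Node)} (h : UnivUnravels T P) :
    UnivUnravels T Pᶜ := fun S g => (h S g).compl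

theorem PosTree.op_iUnion {T : PosTree.{u}} {P : ℕ → Set (ℕ → T.Node)} (h : ∀ n, T.Op (P n)) :
    T.Op (⋃ n, P n) := by
  choose D hD using h
  refine ⟨⋃ n, D n, fun b hb => ?_⟩
  simp only [Set.mem_iUnion, fun n => hD n b hb]
  exact exists_comm

theorem UnivUnravels.iUnion {T : PosTree.{u}} {P : ℕ → Set (ℕ → T.Node)}
    (h : ∀ n, UnivUnravels T (P n)) : UnivUnravels T (⋃ n, P n) := by
  intro S₀ g k
  choose N c hfix hop _ using fun (n : ℕ) (s : Σ S : PosTree.{u}, PosHom S T) =>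
    h n s.1 s.2 (k + n)
  let s : ℕ → Σ S : PosTree.{u}, PosHom S T := fun n =>
    n.rec ⟨S₀, g⟩ fun n s => ⟨N n s, s.2.comp (c n s).toPosHom⟩
  have hc : ∀ n, (c n (s n)).Fix (k + n) := fun n => hfix n (s n)
  let X : ℕ → PosTree.{u} := fun n => (s n).1
  let d : ∀ n, PosCov (X (n + 1)) (X n) := fun n => c n (s n)
  have hd : ∀ n, (d n).Fix (k + n) := hc
  have hcomm : ∀ n (x : (limTree hd).Node), (s n).2.f (x.1 n) = g.f (x.1 0) := by
    intro n x
    induction n with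
    | zero => rfl
    | succ n ih =>
      rw [← ih]
      exact congrArg (s n).2.f (x.2 n)
  have hopen : (limTree hd).Op ((limCov hd).pre (g.pre (⋃ n, P n))) := by
    have : (limCov hd).pre (g.pre (⋃ n, P n)) =
        ⋃ n, (limHom hd (n + 1)).pre ((d n).pre ((s n).2.pre (P n))) := by
      ext b
      simp only [PosHom.pre, Set.mem_iUnion, Set.mem_ofPred_eq]
      refine exists_congr fun n => ?_
      exact iff_of_eq (congrArg (· ∈ P n) (funext fun m => (hcomm (n + 1) (b m)).symm))
    rw [this]
    exact PosTree.op_iUnion fun n => (limHom hd (n + 1)).op_pre (hop n (s n))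
  obtain ⟨S, e, he, h1, h2⟩ := (closed_unravels
    (P := ((limCov hd).pre (g.pre (⋃ n, P n)))ᶜ) (by rwa [compl_compl])).compl k
  rw [compl_compl] at h1 h2
  exact ⟨S, (limCov hd).comp e, (limCov_fix hd).comp he, h1, h2⟩

theorem Unravels.determined {T : PosTree.{u}} {P : Set (ℕ → T.Node)} (h : Unravels T P)
    {x₀ : T.Node} (h₀ : T.len x₀ = 0) (huniq : ∀ x, T.len x = 0 → x = x₀) :
    (∃ σ, T.Leg σ ∧ ∀ b, T.Play false σ b → b ∈ P) ∨
    (∃ σ, T.Leg σ ∧ ∀ b, T.Play true σ b → b ∉ P) := by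
  obtain ⟨S, c, hc, hP, -⟩ := h 0
  obtain ⟨y, hy⟩ := hc.surj x₀ h₀.le
  have push : ∀ (i : Bool) (Q : Set (ℕ → T.Node)), (∃ σ, S.Leg σ ∧
      ∀ b, S.Play i σ b → b 0 = y → b ∈ c.pre Q) → ∃ σ, T.Leg σ ∧ ∀ b, T.Play i σ b → b ∈ Q := by
    rintro i Q ⟨σ, hσ, hw⟩
    refine ⟨c.φ i σ, c.leg i σ hσ, fun b hb => ?_⟩
    obtain ⟨b', hb', hbb⟩ := c.lift i σ hσ b hb
    have hw' := hw b' hb' (hc.inj _ _ hb'.1.1.le (by rw [← c.len, hy, h₀])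
      (by rw [hbb, hy, huniq _ hb.1.1]))
    rwa [← funext hbb]
  exact (S.open_determined _ hP y false).imp (push false P) (push true Pᶜ)

section Translation

variable {A : Type u} {T : Set (List A)}

/-- The positions of a tree of finite sequences. -/
def nodeTree (T : Set (List A)) (hpr : IsPruned T) : PosTree.{u} where
  Node := {x // x ∈ T}
  len x := x.1.length
  Ch x y := ∃ a, y.1 = x.1 ++ [a]
  ch_len := by rintro x y ⟨a, h⟩; simp [h]
  ch_uniq := by
    rintro x y z ⟨a, h⟩ ⟨a', h'⟩
    exact Subtype.ext (List.append_inj_left' (h.symm.trans h') rfl)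
  pruned x := let ⟨a, ha⟩ := hpr x.1 x.2; ⟨⟨_, ha⟩, a, rfl⟩

variable (hpr : IsPruned T)

/-- The sequence of positions of an infinite sequence in the body. -/
def bodyBr (hpr : IsPruned T) (a : {a // a ∈ body T}) (n : ℕ) : (nodeTree T hpr).Node :=
  ⟨List.ofFn fun i : Fin n => a.1 i, a.2 n⟩

theorem ofFn_snoc (a : ℕ → A) (n : ℕ) :
    (List.ofFn fun i : Fin (n + 1) => a i) = (List.ofFn fun i : Fin n => a i) ++ [a n] := by
  rw [List.ofFn_succ']
  simp

theorem isBr_bodyBr (a : {a // a ∈ body T}) : (nodeTree T hpr).IsBr (bodyBr hpr a) :=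
  ⟨rfl, fun n => ⟨a.1 n, ofFn_snoc _ _⟩⟩

theorem bodyBr_injective : Function.Injective (bodyBr hpr) := by
  intro a a' h
  refine Subtype.ext (funext fun n => ?_)
  have h' := congrArg (fun b => (b (n + 1)).1) h
  simp only [bodyBr, ofFn_snoc] at h'
  simpa using List.append_inj_right' h' rfl

theorem exists_bodyBr {b : ℕ → (nodeTree T hpr).Node} (hb : (nodeTree T hpr).IsBr b) :
    ∃ a, bodyBr hpr a = b := by
  choose a ha using hb.2
  have h : ∀ n, (List.ofFn fun i : Fin n => a i) = (b n).1 := by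
    intro n
    induction n with
    | zero => exact (List.eq_nil_of_length_eq_zero hb.1).symm
    | succ n ih => rw [ofFn_snoc, ih, ha]
  exact ⟨⟨a, fun n => h n ▸ (b n).2⟩, funext fun n => Subtype.ext (h n)⟩

theorem nonempty_body (hpr : IsPruned T) (h : [] ∈ T) : Nonempty {a // a ∈ body T} := by
  let x₀ : (nodeTree T hpr).Node := ⟨[], h⟩
  have hb : (nodeTree T hpr).IsBr fun n => ((nodeTree T hpr).pick fun _ _ => True)^[n] x₀ :=
    ⟨rfl, fun n => by
      beta_reduce
      rw [Function.iterate_succ_apply']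
      exact leg_pick _ _⟩
  exact ⟨(exists_bodyBr hpr hb).choose⟩

/-- The sequence in the body described by a branch. -/
noncomputable def toBody (hpr : IsPruned T) [Nonempty {a // a ∈ body T}] :
    (ℕ → (nodeTree T hpr).Node) → {a // a ∈ body T} :=
  Function.invFun (bodyBr hpr)

variable [Nonempty {a // a ∈ body T}]

theorem toBody_bodyBr (a : {a // a ∈ body T}) : toBody hpr (bodyBr hpr a) = a :=
  Function.leftInverse_invFun (bodyBr_injective hpr) a

theorem op_toBody {s : Set {a // a ∈ body T}} (hs : @IsOpen _ (bodyTop T) s) :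
    (nodeTree T hpr).Op (toBody hpr ⁻¹' s) := by
  obtain ⟨V, hV, rfl⟩ := hs
  let : TopologicalSpace A := ⊥
  refine ⟨{x | ∀ a : {a // a ∈ body T}, bodyBr hpr a ((nodeTree T hpr).len x) = x → a.1 ∈ V},
    fun b hb => ?_⟩
  obtain ⟨a, rfl⟩ := exists_bodyBr hpr hb
  simp only [Set.mem_preimage, toBody_bodyBr, Set.mem_ofPred_eq, hb.len]
  constructor
  · intro ha
    obtain ⟨I, u, hu, huV⟩ := isOpen_pi_iff.mp hV _ ha
    refine ⟨I.sup id + 1, fun a' h => huV fun i hi => ?_⟩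
    have hlt : i < I.sup id + 1 := Nat.lt_succ_of_le (Finset.le_sup (f := id) hi)
    have h' : a'.1 i = a.1 i :=
      congrFun (List.ofFn_injective (congrArg Subtype.val h)) ⟨i, hlt⟩
    rw [h']
    exact (hu i hi).2
  · rintro ⟨n, hn⟩
    exact hn a rfl

theorem univUnravels_toBody {s : Set {a // a ∈ body T}}
    (hs : @MeasurableSet _ (@borel _ (bodyTop T)) s) :
    UnivUnravels (nodeTree T hpr) (toBody hpr ⁻¹' s) := by
  induction s, hs using MeasurableSpace.generateFrom_induction with
  | hC s hs _ => exact (op_toBody hpr hs).univUnravels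
  | empty =>
    exact (op_toBody hpr (@isOpen_empty _ (bodyTop T))).univUnravels
  | compl s _ ih => exact ih.compl
  | iUnion s _ ih =>
    rw [Set.preimage_iUnion]
    exact .iUnion ih

omit [Nonempty {a // a ∈ body T}] in
theorem exists_strategy [Inhabited A] {σ : (nodeTree T hpr).Node → (nodeTree T hpr).Node}
    (hσ : (nodeTree T hpr).Leg σ) (i : Bool) {j : ℕ} (hij : ∀ n, Mv i n → n % 2 = j % 2) :
    ∃ s : Strategy T j, ∀ a : {a // a ∈ body T}, a.1 ∈ plays s →
      (nodeTree T hpr).Play i σ (bodyBr hpr a) := by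
  classical
  choose m hm using hσ
  refine ⟨⟨fun x => if h : x ∈ T then m ⟨x, h⟩ else default, fun x hx _ => ?_⟩,
    fun a ha => ⟨isBr_bodyBr hpr a, fun n hn => Subtype.ext ?_⟩⟩
  · rw [dif_pos hx, ← hm ⟨x, hx⟩]
    exact (σ ⟨x, hx⟩).2
  · rw [hm]
    have h := ha.2 n (hij n hn)
    dsimp only at h
    rw [dif_pos (a.2 n)] at h
    exact (ofFn_snoc _ _).trans (congrArg (_ ++ [·]) h)

end Translation

/-- Borel determinacy: every Borel Gale-Stewart game is determined. -/
theorem borel_determinacy {A : Type u} (T : Set (List A)) (P : Set (ℕ → A))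
    (hT : IsTree T) (hpr : IsPruned T) (hne : T.Nonempty)
    (hP : @MeasurableSet _ (@borel _ (bodyTop T)) {a : {a // a ∈ body T} | a.1 ∈ P}) :
    Determined T P := by
  obtain ⟨y, hy⟩ := hne
  have hnil : [] ∈ T := hT List.nil_prefix hy
  have : Inhabited A := ⟨(hpr y hy).choose⟩
  have := nonempty_body hpr hnil
  have hdet := ((univUnravels_toBody hpr hP) _ (.refl _)).determined (x₀ := ⟨[], hnil⟩) rfl
    fun x hx => Subtype.ext (List.eq_nil_of_length_eq_zero hx)
  refine hdet.imp ?_ ?_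
  · rintro ⟨σ, hσ, hw⟩
    obtain ⟨s, hs⟩ := exists_strategy hpr hσ false (j := 0) fun _ h => h
    refine ⟨s, fun a ha => ?_⟩
    have h := hw _ (hs ⟨a, ha.1⟩ ha)
    change (toBody hpr (bodyBr hpr ⟨a, ha.1⟩)).1 ∈ P at h
    rwa [toBody_bodyBr] at h
  · rintro ⟨σ, hσ, hw⟩
    obtain ⟨s, hs⟩ := exists_strategy hpr hσ true (j := 1) fun _ h => h
    refine ⟨s, fun a ha => ?_⟩
    have h := hw _ (hs ⟨a, ha.1⟩ ha)
    change (toBody hpr (bodyBr hpr ⟨a, ha.1⟩)).1 ∉ P at h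
    rwa [toBody_bodyBr] at h

end GS
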